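/- For every integer r ≥ 2 there exist a constant β ≤ O(r) and a universal constant δ > 0 (independent of r) such that for every finite edge-weighted graph G = (V,E) that excludes K_r as a minor and every Δ > 0, there is a probability distribution over partitions of V into clusters of weak diameter at most Δ such that for every vertex z ∈ V and every 0 ≤ γ ≤ δ, the probability that the ball B_G(z, γΔ) is entirely contained in the cluster containing z is at least 2^{−βγ}. Moreover, the distribution can be sampled in polynomial time. -/

import Mathlib

open MeasureTheory Real ENNReal

namespace KPRpaper

variable {V : Type*}

/-- The total weight of a walk in an edge-weighted graph. -/
def walkWeight (w : V → V → ℝ) {G : SimpleGraph V} {x y : V} (p : G.Walk x y) : ℝ :=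
  (p.darts.map (fun d => w d.toProd.1 d.toProd.2)).sum

/-- Shortest-path distance between `x` and `y` using only walks whose vertices all
lie in the set `s` (`⊤` if there is no such walk). -/
noncomputable def dIn (G : SimpleGraph V) (w : V → V → ℝ) (s : Set V) (x y : V) : ℝ≥0∞ :=
  ⨅ p : {p : G.Walk x y // ∀ v ∈ p.support, v ∈ s}, ENNReal.ofReal (walkWeight w p.1)

/-- Shortest-path distance in the whole graph. -/
noncomputable def dG (G : SimpleGraph V) (w : V → V → ℝ) (x y : V) : ℝ≥0∞ :=
  dIn G w Set.univ x y

/-- Distance from a point to a set, within the vertex set `s`. -/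
noncomputable def dSet (G : SimpleGraph V) (w : V → V → ℝ) (s : Set V) (x : V) (A : Set V) :
    ℝ≥0∞ :=
  ⨅ a ∈ A, dIn G w s x a

/-- The ball of radius `ρ` around `z` in the shortest-path metric. -/
def gball (G : SimpleGraph V) (w : V → V → ℝ) (z : V) (ρ : ℝ) : Set V :=
  {v | dG G w z v ≤ ENNReal.ofReal ρ}

/-- The ball of radius `ρ` around the set `A`, inside the induced subgraph on `s`. -/
def gballIn (G : SimpleGraph V) (w : V → V → ℝ) (s A : Set V) (ρ : ℝ) : Set V :=
  {v | v ∈ s ∧ dSet G w s v A ≤ ENNReal.ofReal ρ}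

/-- `G` contains the complete graph `K_q` as a minor: there are `q` pairwise disjoint
nonempty vertex sets, each inducing a connected subgraph, with an edge between any two. -/
def HasCliqueMinor (G : SimpleGraph V) (q : ℕ) : Prop :=
  ∃ S : Fin q → Set V,
    (∀ i, (S i).Nonempty) ∧
    (∀ i, (G.induce (S i)).Connected) ∧
    (∀ i j, i ≠ j → Disjoint (S i) (S j)) ∧
    (∀ i j, i ≠ j → ∃ u ∈ S i, ∃ v ∈ S j, G.Adj u v)

/-- There is a walk from `x` to `y` all of whose vertices lie in `s`. -/
def ReachableIn (G : SimpleGraph V) (s : Set V) (x y : V) : Prop :=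
  ∃ p : G.Walk x y, ∀ v ∈ p.support, v ∈ s


section Walks

variable {G : SimpleGraph V} {w : V → V → ℝ}

@[simp] lemma walkWeight_nil {x : V} : walkWeight w (SimpleGraph.Walk.nil : G.Walk x x) = 0 := by
  simp [walkWeight]

@[simp] lemma walkWeight_cons {x y z : V} (h : G.Adj x y) (p : G.Walk y z) :
    walkWeight w (SimpleGraph.Walk.cons h p) = w x y + walkWeight w p := by
  simp [walkWeight]

lemma walkWeight_append {x y z : V} (p : G.Walk x y) (q : G.Walk y z) :
    walkWeight w (p.append q) = walkWeight w p + walkWeight w q := by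
  simp [walkWeight, SimpleGraph.Walk.darts_append]

lemma walkWeight_reverse (hsymm : ∀ u v, w u v = w v u) {x y : V} (p : G.Walk x y) :
    walkWeight w p.reverse = walkWeight w p := by
  induction p with
  | nil => simp
  | cons h p ih =>
    rw [SimpleGraph.Walk.reverse_cons, walkWeight_append, ih]
    simp [hsymm, add_comm]

lemma walkWeight_nonneg (hw : ∀ u v, G.Adj u v → 0 < w u v) {x y : V} (p : G.Walk x y) :
    0 ≤ walkWeight w p := by
  induction p with
  | nil => simp
  | cons h p ih => rw [walkWeight_cons]; linarith [hw _ _ h]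

/-- Some walk from `x` to `y` inside `s` has weight at most `t`. -/
def ReachLe (G : SimpleGraph V) (w : V → V → ℝ) (s : Set V) (x y : V) (t : ℝ) : Prop :=
  ∃ p : G.Walk x y, (∀ v ∈ p.support, v ∈ s) ∧ walkWeight w p ≤ t

namespace ReachLe

variable {s s' : Set V} {x y z : V} {t t' : ℝ}

lemma refl (hx : x ∈ s) (ht : 0 ≤ t) : ReachLe G w s x x t :=
  ⟨.nil, by simpa using hx, by simpa using ht⟩

lemma trans (h : ReachLe G w s x y t) (h' : ReachLe G w s y z t') :
    ReachLe G w s x z (t + t') := by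
  obtain ⟨p, hp, hpt⟩ := h
  obtain ⟨q, hq, hqt⟩ := h'
  refine ⟨p.append q, fun v hv => ?_, ?_⟩
  · rcases (SimpleGraph.Walk.mem_support_append_iff p q).1 hv with h | h
    exacts [hp v h, hq v h]
  · rw [walkWeight_append]; linarith

lemma symm (hsymm : ∀ u v, w u v = w v u) (h : ReachLe G w s x y t) : ReachLe G w s y x t := by
  obtain ⟨p, hp, hpt⟩ := h
  exact ⟨p.reverse, fun v hv => hp v (by simpa using hv), by rwa [walkWeight_reverse hsymm]⟩

lemma mono (h : ReachLe G w s x y t) (hs : s ⊆ s') (ht : t ≤ t') : ReachLe G w s' x y t' := by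
  obtain ⟨p, hp, hpt⟩ := h
  exact ⟨p, fun v hv => hs (hp v hv), hpt.trans ht⟩

lemma nonneg (hw : ∀ u v, G.Adj u v → 0 < w u v) (h : ReachLe G w s x y t) : 0 ≤ t := by
  obtain ⟨p, -, hpt⟩ := h
  exact (walkWeight_nonneg hw p).trans hpt

lemma left_mem (h : ReachLe G w s x y t) : x ∈ s := by
  obtain ⟨p, hp, -⟩ := h
  exact hp _ p.start_mem_support

lemma right_mem (h : ReachLe G w s x y t) : y ∈ s := by
  obtain ⟨p, hp, -⟩ := h
  exact hp _ p.end_mem_support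

lemma cons (hx : x ∈ s) (hxy : G.Adj x y) (h : ReachLe G w s y z t) :
    ReachLe G w s x z (w x y + t) := by
  obtain ⟨p, hp, hpt⟩ := h
  refine ⟨.cons hxy p, fun v hv => ?_, by rw [walkWeight_cons]; linarith⟩
  rcases List.mem_cons.1 (by simpa using hv) with rfl | h
  exacts [hx, hp v h]

end ReachLe

lemma reachLe_split_of_mem_support {s : Set V} {x y u : V} (p : G.Walk x y)
    (hp : ∀ v ∈ p.support, v ∈ s) (hu : u ∈ p.support) :
    ∃ t₁ t₂, ReachLe G w s x u t₁ ∧ ReachLe G w s u y t₂ ∧ t₁ + t₂ = walkWeight w p := by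
  classical
  refine ⟨walkWeight w (p.takeUntil u hu), walkWeight w (p.dropUntil u hu),
    ⟨_, fun v hv => hp v (p.support_takeUntil_subset_support hu hv), le_rfl⟩,
    ⟨_, fun v hv => hp v (p.support_dropUntil_subset_support hu hv), le_rfl⟩, ?_⟩
  rw [← walkWeight_append, SimpleGraph.Walk.take_spec]

/-- Two vertices of a walk split it into three pieces, in one of the two orders. -/
lemma reachLe_split_of_mem_support₂ {s : Set V} {x y u v : V} (p : G.Walk x y)
    (hp : ∀ a ∈ p.support, a ∈ s) (hu : u ∈ p.support) (hv : v ∈ p.support) :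
    (∃ t₁ t₂ t₃, ReachLe G w s x u t₁ ∧ ReachLe G w s u v t₂ ∧ ReachLe G w s v y t₃ ∧
        t₁ + t₂ + t₃ = walkWeight w p) ∨
      (∃ t₁ t₂ t₃, ReachLe G w s x v t₁ ∧ ReachLe G w s v u t₂ ∧ ReachLe G w s u y t₃ ∧
        t₁ + t₂ + t₃ = walkWeight w p) := by
  classical
  have key : v ∈ (p.takeUntil u hu).support ∨ v ∈ (p.dropUntil u hu).support := by
    rw [← SimpleGraph.Walk.mem_support_append_iff, SimpleGraph.Walk.take_spec]; exact hv
  have hsum : walkWeight w (p.takeUntil u hu) + walkWeight w (p.dropUntil u hu)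
      = walkWeight w p := by
    rw [← walkWeight_append, SimpleGraph.Walk.take_spec]
  have h₁ : ∀ a ∈ (p.takeUntil u hu).support, a ∈ s :=
    fun a ha => hp a (p.support_takeUntil_subset_support hu ha)
  have h₂ : ∀ a ∈ (p.dropUntil u hu).support, a ∈ s :=
    fun a ha => hp a (p.support_dropUntil_subset_support hu ha)
  rcases key with hv | hv
  · obtain ⟨t₁, t₂, a, b, c⟩ := reachLe_split_of_mem_support (w := w) _ h₁ hv
    exact .inr ⟨t₁, t₂, _, a, b, ⟨_, h₂, le_rfl⟩, by linarith⟩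
  · obtain ⟨t₁, t₂, a, b, c⟩ := reachLe_split_of_mem_support (w := w) _ h₂ hv
    exact .inl ⟨_, t₁, t₂, ⟨_, h₁, le_rfl⟩, a, b, by linarith⟩

/-- A short walk stays inside any set containing everything it could reach. -/
lemma ReachLe.restrict (hw : ∀ u v, G.Adj u v → 0 < w u v) {s s' : Set V} {x y : V} {t : ℝ}
    (h : ReachLe G w s x y t) (hs : ∀ v, ReachLe G w s x v t → v ∈ s') :
    ReachLe G w s' x y t := by
  obtain ⟨p, hp, hpt⟩ := h
  refine ⟨p, fun v hv => hs v ?_, hpt⟩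
  obtain ⟨t₁, t₂, h₁, h₂, h₁₂⟩ := reachLe_split_of_mem_support (w := w) p hp hv
  exact h₁.mono subset_rfl (by linarith [h₂.nonneg hw])

/-- A walk ending in `P` decomposes at its first vertex in `P`. -/
lemma ReachLe.exists_first_entry {s P : Set V} {z a : V} {t : ℝ}
    (h : ReachLe G w s z a t) (hz : z ∉ P) (ha : a ∈ P) :
    ∃ v u t₁ t₂, ReachLe G w (s \ P) z v t₁ ∧ G.Adj v u ∧ u ∈ P ∧ ReachLe G w s u a t₂ ∧
      t₁ + w v u + t₂ ≤ t := by
  obtain ⟨p, hp, hpt⟩ := h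
  induction p generalizing t with
  | nil => exact absurd ha hz
  | @cons x y b hxy p ih =>
    rw [walkWeight_cons] at hpt
    have hx : x ∈ s := hp x (by simp)
    have hp' : ∀ v ∈ p.support, v ∈ s := fun v hv => hp v (by simp [hv])
    by_cases hy : y ∈ P
    · exact ⟨x, y, 0, walkWeight w p, ReachLe.refl ⟨hx, hz⟩ le_rfl, hxy, hy,
        ⟨p, hp', le_rfl⟩, by linarith⟩
    · obtain ⟨v, u, t₁, t₂, h₁, h₂, h₃, h₄, h₅⟩ := ih hy ha hp' le_rfl
      exact ⟨v, u, w x y + t₁, t₂, h₁.cons ⟨hx, hz⟩ hxy, h₂, h₃, h₄, by linarith⟩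

/-- The open ball around `z` in the shortest-path metric. -/
def openBall (G : SimpleGraph V) (w : V → V → ℝ) (z : V) (ρ : ℝ) : Set V :=
  {y | ∃ t < ρ, ReachLe G w Set.univ z y t}

lemma reachLe_openBall (hw : ∀ u v, G.Adj u v → 0 < w u v) {z y : V} {ρ t : ℝ} (ht : t < ρ)
    (h : ReachLe G w Set.univ z y t) : ReachLe G w (openBall G w z ρ) z y t :=
  h.restrict hw fun _ hv => ⟨t, ht, hv⟩

lemma dG_le_of_reachLe {x y : V} {t : ℝ} (h : ReachLe G w Set.univ x y t) :
    dG G w x y ≤ ENNReal.ofReal t := by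
  obtain ⟨p, hp, hpt⟩ := h
  exact (iInf_le _ (⟨p, hp⟩ : {p : G.Walk x y // ∀ v ∈ p.support, v ∈ Set.univ})).trans
    (ENNReal.ofReal_le_ofReal hpt)

lemma reachLe_of_dG_le {x y : V} {t ε : ℝ} (ht : 0 ≤ t) (hε : 0 < ε)
    (h : dG G w x y ≤ ENNReal.ofReal t) : ReachLe G w Set.univ x y (t + ε) := by
  have h₁ : dG G w x y < ENNReal.ofReal (t + ε) :=
    h.trans_lt ((ENNReal.ofReal_lt_ofReal_iff (by linarith)).2 (by linarith))
  obtain ⟨p, hp⟩ := iInf_lt_iff.1 h₁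
  exact ⟨p.1, p.2, ((ENNReal.ofReal_lt_ofReal_iff (by linarith)).1 hp).le⟩

/-- The vertices of `s` joined to `z` by a walk inside `s`. -/
def comp (G : SimpleGraph V) (w : V → V → ℝ) (s : Set V) (z : V) : Set V :=
  {y | ∃ t, ReachLe G w s z y t}

lemma ReachLe.in_comp (hw : ∀ u v, G.Adj u v → 0 < w u v) {s : Set V} {z y : V} {t : ℝ}
    (h : ReachLe G w s z y t) : ReachLe G w (comp G w s z) z y t :=
  h.restrict hw fun _ hv => ⟨t, hv⟩

lemma comp_subset {s : Set V} {z : V} : comp G w s z ⊆ s := fun _ ⟨_, h⟩ => h.right_mem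

lemma mem_comp_self {s : Set V} {z : V} (hz : z ∈ s) : z ∈ comp G w s z :=
  ⟨0, ReachLe.refl hz le_rfl⟩

lemma comp_eq_of_mem (hsymm : ∀ u v, w u v = w v u) {s : Set V} {z y : V}
    (hy : y ∈ comp G w s z) : comp G w s y = comp G w s z := by
  obtain ⟨t, ht⟩ := hy
  ext x
  exact ⟨fun ⟨t', h⟩ => ⟨_, ht.trans h⟩, fun ⟨t', h⟩ => ⟨_, (ht.symm hsymm).trans h⟩⟩

/-- Any two vertices of `s` are joined by a walk inside `s`. -/
def PreconnectedIn (G : SimpleGraph V) (w : V → V → ℝ) (s : Set V) : Prop :=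
  ∀ x ∈ s, ∀ y ∈ s, ∃ t, ReachLe G w s x y t

lemma preconnectedIn_of_center (hsymm : ∀ u v, w u v = w v u) {s : Set V} (z : V)
    (h : ∀ x ∈ s, ∃ t, ReachLe G w s z x t) : PreconnectedIn G w s := by
  intro x hx y hy
  obtain ⟨t, ht⟩ := h x hx
  obtain ⟨t', ht'⟩ := h y hy
  exact ⟨_, (ht.symm hsymm).trans ht'⟩

lemma preconnectedIn_comp (hw : ∀ u v, G.Adj u v → 0 < w u v) (hsymm : ∀ u v, w u v = w v u)
    {s : Set V} {z : V} : PreconnectedIn G w (comp G w s z) :=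
  preconnectedIn_of_center hsymm z fun _ ⟨t, h⟩ => ⟨t, h.in_comp hw⟩

lemma PreconnectedIn.connected_induce {s : Set V} (h : PreconnectedIn G w s) (hs : s.Nonempty) :
    (G.induce s).Connected := by
  have : Nonempty s := hs.to_subtype
  refine ⟨fun x y => ?_⟩
  obtain ⟨t, p, hp, -⟩ := h x x.2 y y.2
  exact ⟨p.induce s hp⟩

lemma hasCliqueMinor_of_finset {q : ℕ} {F : Finset (Set V)} (hq : q ≤ F.card)
    (hne : ∀ X ∈ F, X.Nonempty) (hconn : ∀ X ∈ F, PreconnectedIn G w X)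
    (hpair : ∀ X ∈ F, ∀ Y ∈ F, X ≠ Y → Disjoint X Y ∧ ∃ u ∈ X, ∃ v ∈ Y, G.Adj u v) :
    HasCliqueMinor G q := by
  obtain ⟨F', hF', rfl⟩ := Finset.exists_subset_card_eq hq
  let e := F'.equivFin.symm
  have he : ∀ i, (e i : Set V) ∈ F := fun i => hF' (e i).2
  have hne' : ∀ i j, i ≠ j → (e i : Set V) ≠ e j := fun i j hij h =>
    hij (e.injective (Subtype.ext h))
  exact ⟨fun i => e i, fun i => hne _ (he i), fun i => (hconn _ (he i)).connected_induce
    (hne _ (he i)), fun i j hij => (hpair _ (he i) _ (he j) (hne' i j hij)).1,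
    fun i j hij => (hpair _ (he i) _ (he j) (hne' i j hij)).2⟩

end Walks

section Potential

/-- The potential inequality behind the choice of a geometrically distributed radius. -/
lemma sum_geometric_radius_le {r m W n : ℕ} (hm : (16 : ℝ) ^ r ≤ 2 ^ m) {q : ℕ → ℝ}
    (hlo : ∀ l, (1 / 16 : ℝ) ^ r ≤ q l) (hhi : ∀ l, q l ≤ 1) {Ψ : ℕ → ℝ}
    (halive : ∀ j ≤ m, j ≤ n → Ψ j ≤ ∑ l ∈ Finset.range (n + 1 - j), (1 / 2 : ℝ) ^ l * q l +
      (1 / 2 : ℝ) ^ (n - j) * q (n - j) / 16)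
    (hdead : ∀ j ≤ m, n < j → Ψ j ≤ 0) :
    ∑ j ∈ Finset.range (m + 1), (1 / 4 : ℝ) ^ j *
        (Ψ j + if n ≤ j + W then (1 / 4 : ℝ) * (1 / 16) ^ r * (1 / 2) ^ W else 0) ≤
      ∑ j ∈ Finset.range (m + 1), (1 / 4 : ℝ) ^ j * ∑' l, (1 / 2 : ℝ) ^ l * q l := by
  have hq0 : ∀ l, 0 < q l := fun l => lt_of_lt_of_le (by positivity) (hlo l)
  have hsum : Summable fun l => (1 / 2 : ℝ) ^ l * q l :=
    Summable.of_nonneg_of_le (fun l => by have := hq0 l; positivity)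
      (fun l => mul_le_of_le_one_right (by positivity) (hhi l)) summable_geometric_two
  set Φ := ∑' l, (1 / 2 : ℝ) ^ l * q l with hΦ
  set g : ℕ → ℝ := fun j => Φ - ∑ l ∈ Finset.range (n + 1 - j), (1 / 2 : ℝ) ^ l * q l with hg
  have hterm : ∀ j l, n + 1 - j ≤ l → (1 / 2 : ℝ) ^ l * q l ≤ g j := by
    intro j l hl
    have h := hsum.sum_le_tsum (insert l (Finset.range (n + 1 - j)))
      (fun i _ => by have := hq0 i; positivity)
    rw [Finset.sum_insert (by simp; omega)] at h
    simp only [hg]; linarith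
  set L : ℕ → ℝ := fun j => if j ≤ n then (1 / 2 : ℝ) ^ (n - j) * q (n - j) / 16 else 0 with hL
  have hg0 : ∀ j, 0 ≤ g j := fun j =>
    le_trans (by have := hq0 (n + 1 - j); positivity) (hterm j _ le_rfl)
  have hΨ : ∀ j ≤ m, Ψ j ≤ Φ - g j + L j := by
    intro j hj
    by_cases hjn : j ≤ n
    · simpa [hg, hL, hjn] using halive j hj hjn
    · have h : n + 1 - j = 0 := by omega
      simpa [hg, hL, hjn, h] using hdead j hj (by omega)
  have hLg : ∀ j, L j ≤ g (j + 1) / 16 := by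
    intro j
    by_cases hjn : j ≤ n
    · simp only [hL, hjn, if_true]
      linarith [hterm (j + 1) (n - j) (by omega)]
    · simp only [hL, hjn, if_false]
      linarith [hg0 (j + 1)]
  have hLm : (1 / 4 : ℝ) ^ m * L m ≤ g 0 / 4 := by
    by_cases hmn : m ≤ n
    · obtain ⟨d, rfl⟩ := Nat.exists_eq_add_of_le hmn
      have h₁ := hterm 0 (m + d + 1) (by omega)
      have h₂ : (1 / 2 : ℝ) ^ (m + d + 1) * (1 / 16) ^ r ≤ g 0 :=
        (mul_le_mul_of_nonneg_left (hlo _) (by positivity)).trans h₁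
      have h₃ : (1 / 2 : ℝ) ^ m ≤ (1 / 16) ^ r := by
        rw [one_div_pow, one_div_pow]
        exact one_div_le_one_div_of_le (by positivity) hm
      have h₄ : (1 / 4 : ℝ) ^ m * L m ≤ (1 / 4 : ℝ) ^ m * ((1 / 2) ^ d / 16) := by
        refine mul_le_mul_of_nonneg_left ?_ (by positivity)
        simp only [hL, hmn, if_true, Nat.add_sub_cancel_left]
        have := mul_le_of_le_one_right (a := (1 / 2 : ℝ) ^ d) (by positivity) (hhi d)
        linarith
      have h₅ : (1 / 4 : ℝ) ^ m = (1 / 2) ^ m * (1 / 2) ^ m := by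
        rw [← mul_pow]; norm_num
      have h₆ : (1 / 2 : ℝ) ^ m * ((1 / 2) ^ m * (1 / 2) ^ d) ≤
          (1 / 16) ^ r * ((1 / 2) ^ m * (1 / 2) ^ d) :=
        mul_le_mul_of_nonneg_right h₃ (by positivity)
      rw [pow_succ, pow_add] at h₂
      have h₇ : (0 : ℝ) ≤ (1 / 16) ^ r * ((1 / 2) ^ m * (1 / 2) ^ d) := by positivity
      rw [h₅] at h₄
      rw [h₅]
      nlinarith
    · simp only [hL, hmn, if_false, mul_zero]
      linarith [hg0 0]
  have hκ : ∀ j, (if n ≤ j + W then (1 / 4 : ℝ) * (1 / 16) ^ r * (1 / 2) ^ W else 0) ≤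
      g j / 2 := by
    intro j
    split_ifs with h
    · have h₁ := hterm j (n + 1 - j) le_rfl
      have h₂ : (1 / 2 : ℝ) ^ (W + 1) * (1 / 16) ^ r ≤ (1 / 2 : ℝ) ^ (n + 1 - j) * q (n + 1 - j) :=
        mul_le_mul (pow_le_pow_of_le_one (by norm_num) (by norm_num) (by omega)) (hlo _)
          (by positivity) (by positivity)
      rw [pow_succ] at h₂
      nlinarith
    · linarith [hg0 j]
  have hLsum : ∑ j ∈ Finset.range (m + 1), (1 / 4 : ℝ) ^ j * L j ≤
      ∑ j ∈ Finset.range (m + 1), (1 / 4 : ℝ) ^ j * (g j / 4) := by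
    rw [Finset.sum_range_succ, Finset.sum_range_succ']
    refine add_le_add (Finset.sum_le_sum fun j _ => ?_) (by simpa using hLm)
    rw [pow_succ]
    have := mul_le_mul_of_nonneg_left (hLg j) (by positivity : (0 : ℝ) ≤ (1 / 4) ^ j)
    linarith
  calc _ ≤ ∑ j ∈ Finset.range (m + 1), ((1 / 4 : ℝ) ^ j * Φ - (1 / 4 : ℝ) ^ j * (g j / 4) +
        (1 / 4 : ℝ) ^ j * L j) := by
        refine Finset.sum_le_sum fun j hj => ?_
        have h₁ := hΨ j (by simpa [Nat.lt_succ_iff] using hj)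
        have h₂ := hκ j
        have h₃ : (0 : ℝ) ≤ (1 / 4) ^ j := by positivity
        have h₄ := hg0 j
        nlinarith [mul_nonneg h₃ h₄, mul_le_mul_of_nonneg_left (add_le_add h₁ h₂) h₃]
    _ ≤ _ := by
        rw [Finset.sum_add_distrib, Finset.sum_sub_distrib]
        linarith

end Potential


section NearClusters

variable {G : SimpleGraph V} {w : V → V → ℝ}

/-- From any root `v₀` of a connected set there are connected, almost geodesic sets reaching every
vertex, measured against a common `1`-Lipschitz height function. -/
lemma exists_almost_geodesics (hw : ∀ u v, G.Adj u v → 0 < w u v)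
    (hsymm : ∀ u v, w u v = w v u) {U : ℝ} (hU : 0 < U) {s : Set V} (hs : PreconnectedIn G w s)
    {v₀ : V} (hv₀ : v₀ ∈ s) :
    ∃ h : V → ℝ, (∀ x ∈ s, 0 ≤ h x) ∧ (∀ x y t, ReachLe G w s x y t → h y ≤ h x + t) ∧
      ∀ y ∈ s, ∃ Y ⊆ s, v₀ ∈ Y ∧ y ∈ Y ∧ PreconnectedIn G w Y ∧
        ∀ u ∈ Y, ∀ u' ∈ Y, ReachLe G w s u u' (|h u - h u'| + U) := by
  set h : V → ℝ := fun x => sInf {t | ReachLe G w s v₀ x t} with hdef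
  have hbdd : ∀ x, BddBelow {t | ReachLe G w s v₀ x t} := fun x =>
    ⟨0, fun t ht => ReachLe.nonneg hw ht⟩
  have hle : ∀ x t, ReachLe G w s v₀ x t → h x ≤ t := fun x t ht => csInf_le (hbdd x) ht
  have hlip : ∀ x y t, ReachLe G w s x y t → h y ≤ h x + t := by
    intro x y t hxy
    rw [← sub_le_iff_le_add]
    exact le_csInf (hs v₀ hv₀ x hxy.left_mem) fun t' ht' => by
      linarith [hle y _ (ReachLe.trans ht' hxy)]
  refine ⟨h, fun x hx => le_csInf (hs v₀ hv₀ x hx) fun t ht => ReachLe.nonneg hw ht, hlip, ?_⟩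
  intro y hy
  obtain ⟨t, ht, htU⟩ := exists_lt_of_csInf_lt (hs v₀ hv₀ y hy)
    (show sInf {t | ReachLe G w s v₀ y t} < h y + U by simp only [hdef]; linarith)
  obtain ⟨p, hp, hpt⟩ := ht
  have key : ∀ a b t₁ t₂ t₃, ReachLe G w s v₀ a t₁ → ReachLe G w s a b t₂ →
      ReachLe G w s b y t₃ → t₁ + t₂ + t₃ = walkWeight w p →
      ReachLe G w s a b (|h a - h b| + U) := by
    intro a b t₁ t₂ t₃ h₁ h₂ h₃ he
    refine h₂.mono subset_rfl ?_
    have h₄ := hle a _ h₁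
    have h₅ := hlip _ _ _ h₃
    have h₆ := neg_abs_le (h a - h b)
    linarith
  refine ⟨{v | v ∈ p.support}, hp, p.start_mem_support, p.end_mem_support,
    preconnectedIn_of_center hsymm v₀ fun x hx => ?_, fun u hu u' hu' => ?_⟩
  · obtain ⟨t₁, t₂, h₁, -, -⟩ :=
      reachLe_split_of_mem_support (w := w) (s := {v | v ∈ p.support}) p (fun v hv => hv) hx
    exact ⟨t₁, h₁⟩
  · rcases reachLe_split_of_mem_support₂ (w := w) p hp hu hu' with
      ⟨t₁, t₂, t₃, h₁, h₂, h₃, he⟩ | ⟨t₁, t₂, t₃, h₁, h₂, h₃, he⟩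
    · exact key _ _ _ _ _ h₁ h₂ h₃ he
    · rw [abs_sub_comm]
      exact (key _ _ _ _ _ h₁ h₂ h₃ he).symm hsymm

/-- The vertices of `s` within distance `R` of the part of `Y` at height `[i * ν, (i + 1) * ν)`. -/
def nearCluster (G : SimpleGraph V) (w : V → V → ℝ) (s : Set V) (h : V → ℝ) (ν R : ℝ) (Y : Set V)
    (i : ℕ) : Set V :=
  {v | ∃ u ∈ Y, i * ν ≤ h u ∧ h u < (i + 1) * ν ∧ ReachLe G w s v u R}

variable {s Y : Set V} {h : V → ℝ} {ν R : ℝ} {i : ℕ}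

lemma nearCluster_subset : nearCluster G w s h ν R Y i ⊆ s := fun _ ⟨_, _, _, _, h⟩ => h.left_mem

lemma nearCluster_bounded (hsymm : ∀ u v, w u v = w v u) {U : ℝ}
    (hY : ∀ u ∈ Y, ∀ u' ∈ Y, ReachLe G w s u u' (|h u - h u'| + U)) {x y : V}
    (hx : x ∈ nearCluster G w s h ν R Y i) (hy : y ∈ nearCluster G w s h ν R Y i) :
    ReachLe G w Set.univ x y (2 * R + ν + U) := by
  obtain ⟨u, hu, hu₁, hu₂, hxu⟩ := hx
  obtain ⟨u', hu', hu₁', hu₂', hyu⟩ := hy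
  refine ((hxu.trans (hY u hu u' hu')).trans (hyu.symm hsymm)).mono (Set.subset_univ _) ?_
  have : |h u - h u'| ≤ ν := by rw [abs_le]; constructor <;> linarith
  linarith

lemma card_nearCluster_le [Fintype V] [DecidableEq (Set V)] (hsymm : ∀ u v, w u v = w v u)
    (hh : ∀ x ∈ s, 0 ≤ h x) (hlip : ∀ x y t, ReachLe G w s x y t → h y ≤ h x + t)
    (hν : 0 < ν) (hR : R ≤ ν) (𝒴 : Finset (Set V)) (z : V) (T : Finset (Set V))
    (hT : ∀ C ∈ T, z ∈ C ∧ ∃ Y ∈ 𝒴, ∃ i, C = nearCluster G w s h ν R Y i) :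
    T.card ≤ 3 * 𝒴.card := by
  set i₀ := ⌊h z / ν⌋₊ with hi₀
  have hsub : T ⊆ (𝒴 ×ˢ Finset.Icc (i₀ - 1) (i₀ + 1)).image
      fun q => nearCluster G w s h ν R q.1 q.2 := by
    intro C hC
    obtain ⟨hzC, Y, hY, i, rfl⟩ := hT C hC
    refine Finset.mem_image.2 ⟨(Y, i), Finset.mem_product.2 ⟨hY, ?_⟩, rfl⟩
    obtain ⟨u, hu, hu₁, hu₂, hzu⟩ := hzC
    have h₁ := hlip _ _ _ hzu
    have h₂ := hlip _ _ _ (hzu.symm hsymm)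
    have h₃ : (i₀ : ℝ) * ν ≤ h z := by
      rw [← le_div_iff₀ hν]
      exact Nat.floor_le (div_nonneg (hh z hzu.left_mem) hν.le)
    have h₄ : h z < (i₀ + 1) * ν := by
      rw [← div_lt_iff₀ hν]
      exact Nat.lt_floor_add_one _
    have h₅ : (i : ℝ) < i₀ + 2 := by
      by_contra! hc
      nlinarith
    have h₆ : (i₀ : ℝ) < i + 2 := by
      by_contra! hc
      nlinarith
    have h₅' : i < i₀ + 2 := by exact_mod_cast h₅
    have h₆' : i₀ < i + 2 := by exact_mod_cast h₆
    simp only [Finset.mem_Icc]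
    omega
  calc T.card ≤ _ := Finset.card_le_card hsub
    _ ≤ _ := Finset.card_image_le
    _ = 𝒴.card * (i₀ + 1 + 1 - (i₀ - 1)) := by rw [Finset.card_product, Nat.card_Icc]
    _ ≤ 𝒴.card * 3 := Nat.mul_le_mul_left _ (by omega)
    _ = 3 * 𝒴.card := mul_comm _ _

end NearClusters

section FracCover

open scoped Classical

variable [Fintype V] {G : SimpleGraph V} {w : V → V → ℝ}

/-- Nonnegative weights `μ` on the subsets of `s`, supported on sets of weak diameter at most `D`,
such that every `ρ`-ball inside `s` is fractionally covered and every `z ∈ s` has load at most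
`B z`. -/
structure IsFracCover (G : SimpleGraph V) (w : V → V → ℝ) (s : Set V) (D ρ : ℝ) (B : V → ℝ)
    (μ : Set V → ℝ) : Prop where
  nonneg : ∀ C, 0 ≤ μ C
  subset : ∀ C, μ C ≠ 0 → C ⊆ s
  bounded : ∀ C, μ C ≠ 0 → ∀ x ∈ C, ∀ y ∈ C, ReachLe G w Set.univ x y D
  padded : ∀ z, openBall G w z ρ ⊆ s → 1 ≤ ∑ C, if openBall G w z ρ ⊆ C then μ C else 0
  load : ∀ z ∈ s, ∑ C, (if z ∈ C then μ C else 0) ≤ B z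

namespace IsFracCover

variable {s : Set V} {D ρ : ℝ} {B : V → ℝ} {μ : Set V → ℝ}

lemma load_eq_zero (h : IsFracCover G w s D ρ B μ) {z : V} (hz : z ∉ s) :
    ∑ C, (if z ∈ C then μ C else 0) = 0 := by
  refine Finset.sum_eq_zero fun C _ => ?_
  split_ifs with hC
  · by_contra hne
    exact hz (h.subset C hne hC)
  · rfl

/-- Fractional covers of the connected components combine to one of the whole set. -/
lemma of_components (hw : ∀ u v, G.Adj u v → 0 < w u v) (hsymm : ∀ u v, w u v = w v u)
    (hρ : 0 < ρ) {B : Set V → V → ℝ}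
    (h : ∀ z ∈ s, ∃ μ, IsFracCover G w (comp G w s z) D ρ (B (comp G w s z)) μ) :
    ∃ μ, IsFracCover G w s D ρ (fun z => B (comp G w s z) z) μ := by
  have h' : ∀ c : Set V, ∃ μ, (∃ z ∈ s, c = comp G w s z) → IsFracCover G w c D ρ (B c) μ := by
    intro c
    by_cases hc : ∃ z ∈ s, c = comp G w s z
    · obtain ⟨z, hz, rfl⟩ := hc
      obtain ⟨μ, hμ⟩ := h z hz
      exact ⟨μ, fun _ => hμ⟩
    · exact ⟨0, fun h => absurd h hc⟩
  choose M hM using h'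
  set Q : Finset (Set V) := Finset.univ.filter fun c => ∃ z ∈ s, c = comp G w s z with hQ
  have hM' : ∀ c ∈ Q, IsFracCover G w c D ρ (B c) (M c) := fun c hc =>
    hM c (Finset.mem_filter.1 hc).2
  have hmem : ∀ z ∈ s, comp G w s z ∈ Q := fun z hz => by
    simp only [hQ, Finset.mem_filter, Finset.mem_univ, true_and]
    exact ⟨z, hz, rfl⟩
  have hne : ∀ C, ∑ c ∈ Q, M c C ≠ 0 → ∃ c ∈ Q, M c C ≠ 0 := fun C hC =>
    Finset.exists_ne_zero_of_sum_ne_zero hC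
  have hswap : ∀ p : Set V → Prop, ∑ C, (if p C then ∑ c ∈ Q, M c C else 0) =
      ∑ c ∈ Q, ∑ C, if p C then M c C else 0 := by
    intro p
    rw [Finset.sum_comm]
    refine Finset.sum_congr rfl fun C _ => ?_
    split_ifs <;> simp
  refine ⟨fun C => ∑ c ∈ Q, M c C, fun C => Finset.sum_nonneg fun c hc => (hM' c hc).nonneg C,
    fun C hC => ?_, fun C hC => ?_, fun z hz => ?_, fun z hz => ?_⟩
  · obtain ⟨c, hc, hcC⟩ := hne C hC
    obtain ⟨z, -, rfl⟩ := (Finset.mem_filter.1 hc).2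
    exact ((hM' _ hc).subset C hcC).trans comp_subset
  · obtain ⟨c, hc, hcC⟩ := hne C hC
    exact (hM' c hc).bounded C hcC
  · have hzs : z ∈ s := hz ⟨0, hρ, ReachLe.refl (Set.mem_univ _) le_rfl⟩
    have hsub : openBall G w z ρ ⊆ comp G w s z := by
      rintro y ⟨t, ht, hy⟩
      exact ⟨t, (reachLe_openBall hw ht hy).mono hz le_rfl⟩
    rw [hswap]
    refine ((hM' _ (hmem z hzs)).padded z hsub).trans
      (Finset.single_le_sum (f := fun c => ∑ C, if openBall G w z ρ ⊆ C then M c C else 0)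
        (fun c hc => Finset.sum_nonneg fun C _ => ?_) (hmem z hzs))
    split_ifs
    exacts [(hM' c hc).nonneg C, le_rfl]
  · rw [hswap, Finset.sum_eq_single (comp G w s z)]
    · exact (hM' _ (hmem z hz)).load z (mem_comp_self hz)
    · intro c hc hcz
      refine (hM' c hc).load_eq_zero fun hzc => hcz ?_
      obtain ⟨y, -, rfl⟩ := (Finset.mem_filter.1 hc).2
      exact (comp_eq_of_mem hsymm hzc).symm
    · exact fun h => absurd (hmem z hz) h

/-- Averaging: at level `j`, the balls inside `s` are covered either by an explicit finite family
of sets or by a fractional cover of the remainder `s \ P j`. -/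
lemma average {m : ℕ} {a : ℕ → ℝ} (ha : ∀ j, 0 < a j) {P : ℕ → Set V} {𝒩 : ℕ → Finset (Set V)}
    {Ψ : ℕ → V → ℝ} {M : ℕ → Set V → ℝ} {cnt : ℕ → V → ℝ}
    (h𝒩s : ∀ j ≤ m, ∀ C ∈ 𝒩 j, C ⊆ s)
    (h𝒩D : ∀ j ≤ m, ∀ C ∈ 𝒩 j, ∀ x ∈ C, ∀ y ∈ C, ReachLe G w Set.univ x y D)
    (hM : ∀ j ≤ m, IsFracCover G w (s \ P j) D ρ (Ψ j) (M j))
    (hcov : ∀ z, openBall G w z ρ ⊆ s → ∀ j ≤ m,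
      (∃ C ∈ 𝒩 j, openBall G w z ρ ⊆ C) ∨ openBall G w z ρ ⊆ s \ P j)
    (hcnt : ∀ z ∈ s, ∀ j ≤ m, (((𝒩 j).filter fun C => z ∈ C).card : ℝ) ≤ cnt j z)
    (hB : ∀ z ∈ s, ∑ j ∈ Finset.range (m + 1),
      a j * (cnt j z + if z ∈ s \ P j then Ψ j z else 0) ≤
        (∑ j ∈ Finset.range (m + 1), a j) * B z) :
    ∃ μ, IsFracCover G w s D ρ B μ := by
  set c := ∑ j ∈ Finset.range (m + 1), a j with hc
  have hc0 : 0 < c := Finset.sum_pos (fun j _ => ha j) ⟨0, by simp⟩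
  have hjm : ∀ j ∈ Finset.range (m + 1), j ≤ m := fun j hj => by
    have := Finset.mem_range.1 hj
    omega
  set N : ℕ → Set V → ℝ := fun j C => (if C ∈ 𝒩 j then 1 else 0) + M j C with hN
  have hN0 : ∀ j ≤ m, ∀ C, 0 ≤ N j C := fun j hj C =>
    add_nonneg (by split_ifs <;> norm_num) ((hM j hj).nonneg C)
  have hNne : ∀ j ≤ m, ∀ C, N j C ≠ 0 → C ∈ 𝒩 j ∨ M j C ≠ 0 := by
    intro j _ C h
    by_contra! hcon
    exact h (by simp [hN, hcon.1, hcon.2])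
  have hne : ∀ C, c⁻¹ * ∑ j ∈ Finset.range (m + 1), a j * N j C ≠ 0 →
      ∃ j ≤ m, C ∈ 𝒩 j ∨ M j C ≠ 0 := by
    intro C h
    obtain ⟨j, hj, hne⟩ := Finset.exists_ne_zero_of_sum_ne_zero (right_ne_zero_of_mul h)
    exact ⟨j, hjm j hj, hNne j (hjm j hj) C (right_ne_zero_of_mul hne)⟩
  have hswap : ∀ p : Set V → Prop,
      ∑ C, (if p C then c⁻¹ * ∑ j ∈ Finset.range (m + 1), a j * N j C else 0) =
      c⁻¹ * ∑ j ∈ Finset.range (m + 1), a j * ∑ C, if p C then N j C else 0 := by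
    intro p
    simp only [Finset.mul_sum]
    rw [Finset.sum_comm]
    refine Finset.sum_congr rfl fun C _ => ?_
    split_ifs <;> simp
  have hsplit : ∀ (p : Set V → Prop) j, ∑ C, (if p C then N j C else 0) =
      (((𝒩 j).filter p).card : ℝ) + ∑ C, if p C then M j C else 0 := by
    intro p j
    have : (((𝒩 j).filter p).card : ℝ) =
        ∑ C, if p C then (if C ∈ 𝒩 j then (1 : ℝ) else 0) else 0 := by
      rw [Finset.card_eq_sum_ones, Nat.cast_sum, ← Finset.sum_filter, ← Finset.sum_filter]
      refine Finset.sum_congr ?_ fun _ _ => by simp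
      ext C
      simp [and_comm]
    rw [this, ← Finset.sum_add_distrib]
    refine Finset.sum_congr rfl fun C _ => ?_
    split_ifs <;> simp_all
  have hM0 : ∀ (p : Set V → Prop), ∀ j ≤ m, 0 ≤ ∑ C, if p C then M j C else 0 :=
    fun p j hj => Finset.sum_nonneg fun C _ => by
      split_ifs
      exacts [(hM j hj).nonneg C, le_rfl]
  refine ⟨fun C => c⁻¹ * ∑ j ∈ Finset.range (m + 1), a j * N j C, fun C => ?_, fun C hC => ?_,
    fun C hC => ?_, fun z hz => ?_, fun z hz => ?_⟩
  · exact mul_nonneg (inv_nonneg.2 hc0.le) (Finset.sum_nonneg fun j hj =>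
      mul_nonneg (ha j).le (hN0 j (hjm j hj) C))
  · obtain ⟨j, hj, h | h⟩ := hne C hC
    · exact h𝒩s j hj C h
    · exact ((hM j hj).subset C h).trans Set.sdiff_subset
  · obtain ⟨j, hj, h | h⟩ := hne C hC
    · exact h𝒩D j hj C h
    · exact (hM j hj).bounded C h
  · rw [hswap, inv_mul_eq_div, le_div_iff₀ hc0, one_mul]
    refine Finset.sum_le_sum fun j hj => le_mul_of_one_le_right (ha j).le ?_
    rw [hsplit]
    rcases hcov z hz j (hjm j hj) with ⟨C, hC, hzC⟩ | h
    · have : 1 ≤ ((𝒩 j).filter fun C => openBall G w z ρ ⊆ C).card :=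
        Finset.card_pos.2 ⟨C, Finset.mem_filter.2 ⟨hC, hzC⟩⟩
      have : (1 : ℝ) ≤ ((𝒩 j).filter fun C => openBall G w z ρ ⊆ C).card := by exact_mod_cast this
      linarith [hM0 (fun C => openBall G w z ρ ⊆ C) j (hjm j hj)]
    · linarith [(hM j (hjm j hj)).padded z h,
        Nat.cast_nonneg (α := ℝ) ((𝒩 j).filter fun C => openBall G w z ρ ⊆ C).card]
  · rw [hswap, inv_mul_le_iff₀ hc0]
    refine le_trans (Finset.sum_le_sum fun j hj => ?_) (hB z hz)
    refine mul_le_mul_of_nonneg_left ?_ (ha j).le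
    rw [hsplit]
    refine add_le_add (hcnt z hz j (hjm j hj)) ?_
    split_ifs with hzP
    · exact (hM j (hjm j hj)).load z hzP
    · exact ((hM j (hjm j hj)).load_eq_zero hzP).le

end IsFracCover

end FracCover

section MinorState

open scoped Classical

variable {G : SimpleGraph V} {w : V → V → ℝ}

/-- A connected region `s` together with pairwise adjacent, disjoint connected sets `𝒳`, all
adjacent to `s`. The relation `Q X v y` records that from `v ∈ s` one can step into `X` at
cost `y`. -/
structure IsMinorState (G : SimpleGraph V) (w : V → V → ℝ) (s : Set V) (𝒳 : Finset (Set V))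
    (Q : Set V → V → ℝ → Prop) : Prop where
  nonempty : s.Nonempty
  preconnected : PreconnectedIn G w s
  nonempty_of_mem : ∀ X ∈ 𝒳, X.Nonempty
  preconnected_of_mem : ∀ X ∈ 𝒳, PreconnectedIn G w X
  disjoint : ∀ X ∈ 𝒳, Disjoint X s
  touch : ∀ X ∈ 𝒳, ∃ u ∈ X, ∃ v ∈ s, G.Adj u v
  pair : ∀ X ∈ 𝒳, ∀ Y ∈ 𝒳, X ≠ Y → Disjoint X Y ∧ ∃ u ∈ X, ∃ v ∈ Y, G.Adj u v
  port : ∀ X ∈ 𝒳, ∀ v ∈ s, ∀ y, Q X v y → 0 ≤ y ∧ ∃ u ∈ X, G.Adj u v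

namespace IsMinorState

variable {s : Set V} {𝒳 : Finset (Set V)} {Q : Set V → V → ℝ → Prop}

lemma card_lt (h : IsMinorState G w s 𝒳 Q) {r : ℕ} (hr : ¬ HasCliqueMinor G r) :
    𝒳.card + 1 < r := by
  by_contra! hc
  have hs : s ∉ 𝒳 := fun hs => by
    obtain ⟨x, hx⟩ := h.nonempty
    exact Set.disjoint_left.1 (h.disjoint s hs) hx hx
  refine hr (hasCliqueMinor_of_finset (w := w) (F := insert s 𝒳)
    (by rwa [Finset.card_insert_of_notMem hs]) ?_ ?_ ?_)
  · simpa [h.nonempty] using h.nonempty_of_mem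
  · simpa [h.preconnected] using h.preconnected_of_mem
  · intro X hX Y hY hXY
    rcases Finset.mem_insert.1 hX with rfl | hX' <;> rcases Finset.mem_insert.1 hY with rfl | hY'
    · exact absurd rfl hXY
    · obtain ⟨u, hu, v, hv, huv⟩ := h.touch Y hY'
      exact ⟨(h.disjoint Y hY').symm, v, hv, u, hu, huv.symm⟩
    · exact ⟨h.disjoint X hX', h.touch X hX'⟩
    · exact h.pair X hX' Y hY' hXY

end IsMinorState

/-- `X` can be entered from `z` through `s` at total cost less than `x`. -/
def Link (G : SimpleGraph V) (w : V → V → ℝ) (s : Set V) (Q : V → ℝ → Prop) (z : V) (x : ℝ) :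
    Prop :=
  ∃ v y t, ReachLe G w s z v t ∧ Q v y ∧ t + y < x

/-- The number of members of `𝒳` that can be entered from `z` at cost less than `x`. -/
noncomputable def linkCount (G : SimpleGraph V) (w : V → V → ℝ) (s : Set V) (𝒳 : Finset (Set V))
    (Q : Set V → V → ℝ → Prop) (z : V) (x : ℝ) : ℕ :=
  (𝒳.filter fun X => Link G w s (Q X) z x).card

/-- The vertices of `s` within distance `R` of `A` inside `s`. -/
def thicken (G : SimpleGraph V) (w : V → V → ℝ) (s A : Set V) (R : ℝ) : Set V :=
  {v | ∃ a ∈ A, ReachLe G w s v a R}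

/-- The members of `𝒳` adjacent to `s'`, together with a new member `P`. -/
noncomputable def extendFamily (G : SimpleGraph V) (s' : Set V) (𝒳 : Finset (Set V)) (P : Set V) :
    Finset (Set V) :=
  insert P (𝒳.filter fun X => ∃ u ∈ X, ∃ v ∈ s', G.Adj u v)

/-- The costs of entering the members of `extendFamily`, where `P = thicken G w s A R` is entered at
the distance to `A` reduced by `R`. -/
def extendPort (G : SimpleGraph V) (w : V → V → ℝ) (s A : Set V) (R : ℝ)
    (Q : Set V → V → ℝ → Prop) (X : Set V) (v : V) (y : ℝ) : Prop :=
  if X = thicken G w s A R then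
    ∃ u ∈ thicken G w s A R, G.Adj v u ∧ ∃ a ∈ A, ∃ t, ReachLe G w s u a t ∧ y = w v u + t - R
  else Q X v y

variable {s A : Set V} {R : ℝ} {𝒳 : Finset (Set V)} {Q : Set V → V → ℝ → Prop}

lemma thicken_subset : thicken G w s A R ⊆ s := fun _ ⟨_, _, h⟩ => h.left_mem

lemma subset_thicken (hA : A ⊆ s) (hR : 0 ≤ R) : A ⊆ thicken G w s A R :=
  fun a ha => ⟨a, ha, ReachLe.refl (hA ha) hR⟩

lemma preconnectedIn_thicken (hw : ∀ u v, G.Adj u v → 0 < w u v) (hsymm : ∀ u v, w u v = w v u)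
    (hA : A ⊆ s) (hR : 0 ≤ R) (hc : PreconnectedIn G w A) :
    PreconnectedIn G w (thicken G w s A R) := by
  have key : ∀ x ∈ thicken G w s A R, ∃ a ∈ A, ∃ t, ReachLe G w (thicken G w s A R) x a t := by
    rintro x ⟨a, ha, h⟩
    refine ⟨a, ha, R, ?_⟩
    have hsub : ∀ v, ReachLe G w s a v R → v ∈ thicken G w s A R :=
      fun v hv => ⟨a, ha, hv.symm hsymm⟩
    exact ((h.symm hsymm).restrict hw hsub).symm hsymm
  intro x hx y hy
  obtain ⟨a, ha, t, hxa⟩ := key x hx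
  obtain ⟨b, hb, t', hyb⟩ := key y hy
  obtain ⟨t'', hab⟩ := hc a ha b hb
  exact ⟨_, (hxa.trans (hab.mono (subset_thicken hA hR) le_rfl)).trans (hyb.symm hsymm)⟩

lemma thicken_notMem (hS : IsMinorState G w s 𝒳 Q) (hA : A ⊆ s) (hne : A.Nonempty) (hR : 0 ≤ R) :
    thicken G w s A R ∉ 𝒳 := fun h => by
  obtain ⟨a, ha⟩ := hne
  exact Set.disjoint_left.1 (hS.disjoint _ h) (subset_thicken hA hR ha) (hA ha)

lemma IsMinorState.extend (hw : ∀ u v, G.Adj u v → 0 < w u v) (hsymm : ∀ u v, w u v = w v u)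
    (hS : IsMinorState G w s 𝒳 Q) (hA : A ⊆ s) (hne : A.Nonempty) (hc : PreconnectedIn G w A)
    (hR : 0 ≤ R) (htouch : ∀ X ∈ 𝒳, ∃ u ∈ X, ∃ v ∈ A, G.Adj u v) {z : V}
    (hz : z ∈ s \ thicken G w s A R) :
    IsMinorState G w (comp G w (s \ thicken G w s A R) z)
      (extendFamily G (comp G w (s \ thicken G w s A R) z) 𝒳 (thicken G w s A R))
      (extendPort G w s A R Q) := by
  set P := thicken G w s A R with hP
  set s' := comp G w (s \ P) z with hs'
  have hAP : A ⊆ P := subset_thicken hA hR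
  have hs's : s' ⊆ s \ P := comp_subset
  have hmem : ∀ X ∈ extendFamily G s' 𝒳 P, X = P ∨ X ∈ 𝒳 ∧ ∃ u ∈ X, ∃ v ∈ s', G.Adj u v := by
    intro X hX
    simpa [extendFamily] using hX
  have hPtouch : ∃ u ∈ P, ∃ v ∈ s', G.Adj u v := by
    obtain ⟨a, ha⟩ := hne
    obtain ⟨t, ht⟩ := hS.preconnected z hz.1 a (hA ha)
    obtain ⟨v, u, t₁, t₂, h₁, huv, hu, -, -⟩ := ht.exists_first_entry hz.2 (hAP ha)
    exact ⟨u, hu, v, ⟨t₁, h₁⟩, huv.symm⟩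
  have hPX : ∀ X ∈ 𝒳, Disjoint X P ∧ ∃ u ∈ X, ∃ v ∈ P, G.Adj u v := by
    intro X hX
    obtain ⟨u, hu, v, hv, huv⟩ := htouch X hX
    exact ⟨(hS.disjoint X hX).mono_right thicken_subset, u, hu, v, hAP hv, huv⟩
  refine ⟨⟨z, mem_comp_self (s := s \ P) hz⟩, preconnectedIn_comp hw hsymm, ?_, ?_, ?_, ?_, ?_, ?_⟩
  · intro X hX
    rcases hmem X hX with rfl | ⟨hX, -⟩
    exacts [hne.mono hAP, hS.nonempty_of_mem X hX]
  · intro X hX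
    rcases hmem X hX with rfl | ⟨hX, -⟩
    exacts [preconnectedIn_thicken hw hsymm hA hR hc, hS.preconnected_of_mem X hX]
  · intro X hX
    rcases hmem X hX with rfl | ⟨hX, -⟩
    · exact Set.disjoint_left.2 fun x hx hx' => (hs's hx').2 hx
    · exact (hS.disjoint X hX).mono_right fun x hx => (hs's hx).1
  · intro X hX
    rcases hmem X hX with rfl | ⟨hX, h⟩
    exacts [hPtouch, h]
  · intro X hX Y hY hXY
    rcases hmem X hX with rfl | ⟨hX, -⟩ <;> rcases hmem Y hY with rfl | ⟨hY, -⟩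
    · exact absurd rfl hXY
    · obtain ⟨hd, u, hu, v, hv, huv⟩ := hPX Y hY
      exact ⟨hd.symm, v, hv, u, hu, huv.symm⟩
    · exact hPX X hX
    · exact hS.pair X hX Y hY hXY
  · intro X hX v hv y hQ
    rcases hmem X hX with rfl | ⟨hX, -⟩
    · simp only [extendPort, ← hP, if_true] at hQ
      obtain ⟨u, hu, hvu, a, ha, t, hua, rfl⟩ := hQ
      refine ⟨?_, u, hu, hvu.symm⟩
      by_contra! hlt
      exact (hs's hv).2 ⟨a, ha, (ReachLe.cons (hs's hv).1 hvu hua).mono subset_rfl (by linarith)⟩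
    · rw [extendPort, if_neg fun h => thicken_notMem hS hA hne hR (by rwa [← h])] at hQ
      exact hS.port X hX v (hs's hv).1 y hQ

/-- Links cheap enough to avoid `thicken G w s A R` survive in the component of `z`. -/
lemma Link.extend (hw : ∀ u v, G.Adj u v → 0 < w u v)
    (hS : IsMinorState G w s 𝒳 Q) (hA : A ⊆ s) (hne : A.Nonempty) (hR : 0 ≤ R) {z : V} {L x : ℝ}
    (hL : ∀ a ∈ A, ∀ t < L, ¬ ReachLe G w s z a t) (hx : x + R ≤ L) {X : Set V} (hX : X ∈ 𝒳)
    (h : Link G w s (Q X) z x) :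
    X ∈ (extendFamily G (comp G w (s \ thicken G w s A R) z) 𝒳 (thicken G w s A R)).filter
      fun X => Link G w (comp G w (s \ thicken G w s A R) z) (extendPort G w s A R Q X) z x := by
  obtain ⟨v, y, t, hv, hQ, hlt⟩ := h
  obtain ⟨hy, u, hu, huv⟩ := hS.port X hX v hv.right_mem y hQ
  have hv' : ReachLe G w (comp G w (s \ thicken G w s A R) z) z v t := by
    refine ReachLe.in_comp hw (hv.restrict (s' := s \ thicken G w s A R) hw fun x' hx' =>
      ⟨hx'.right_mem, ?_⟩)
    rintro ⟨a, ha, hxa⟩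
    exact hL a ha _ (by linarith) (hx'.trans hxa)
  refine Finset.mem_filter.2
    ⟨Finset.mem_insert_of_mem (Finset.mem_filter.2 ⟨hX, u, hu, v, hv'.right_mem, huv⟩),
      v, y, t, hv', ?_, hlt⟩
  rwa [extendPort, if_neg fun h => thicken_notMem hS hA hne hR (by rwa [← h])]

lemma linkCount_le_extend (hw : ∀ u v, G.Adj u v → 0 < w u v)
    (hS : IsMinorState G w s 𝒳 Q) (hA : A ⊆ s) (hne : A.Nonempty) (hR : 0 ≤ R) {z : V} {L x : ℝ}
    (hL : ∀ a ∈ A, ∀ t < L, ¬ ReachLe G w s z a t) (hx : x + R ≤ L) :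
    linkCount G w s 𝒳 Q z x ≤ linkCount G w (comp G w (s \ thicken G w s A R) z)
      (extendFamily G (comp G w (s \ thicken G w s A R) z) 𝒳 (thicken G w s A R))
      (extendPort G w s A R Q) z x := by
  refine Finset.card_le_card fun X hX => ?_
  obtain ⟨hX, h⟩ := Finset.mem_filter.1 hX
  exact Link.extend hw hS hA hne hR hL hx hX h

lemma linkCount_lt_extend (hw : ∀ u v, G.Adj u v → 0 < w u v)
    (hS : IsMinorState G w s 𝒳 Q) (hA : A ⊆ s) (hne : A.Nonempty) (hR : 0 ≤ R) {z : V} {L x x' : ℝ}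
    (hz : z ∉ thicken G w s A R)
    (hL : ∀ a ∈ A, ∀ t < L, ¬ ReachLe G w s z a t) (hx : x + R ≤ L) (hxx' : x ≤ x')
    {a : V} (ha : a ∈ A) {t : ℝ} (hza : ReachLe G w s z a t) (ht : t < x' + R) :
    linkCount G w s 𝒳 Q z x + 1 ≤ linkCount G w (comp G w (s \ thicken G w s A R) z)
      (extendFamily G (comp G w (s \ thicken G w s A R) z) 𝒳 (thicken G w s A R))
      (extendPort G w s A R Q) z x' := by
  obtain ⟨v, u, t₁, t₂, h₁, hvu, hu, h₂, hle⟩ := hza.exists_first_entry hz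
    (subset_thicken hA hR ha)
  rw [linkCount, ← Finset.card_insert_of_notMem
    fun h => thicken_notMem hS hA hne hR (Finset.mem_filter.1 h).1]
  refine Finset.card_le_card fun X hX => ?_
  rcases Finset.mem_insert.1 hX with rfl | hX
  · refine Finset.mem_filter.2 ⟨Finset.mem_insert_self _ _, v, w v u + t₂ - R, t₁,
      h₁.in_comp hw, ?_, by linarith⟩
    simp only [extendPort, if_true]
    exact ⟨u, hu, hvu, a, ha, t₂, h₂, rfl⟩
  · obtain ⟨hX, h⟩ := Finset.mem_filter.1 hX
    obtain ⟨hX, v, y, t, hv, hQ, hlt⟩ := Finset.mem_filter.1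
      (Link.extend hw hS hA hne hR hL hx hX h)
    exact Finset.mem_filter.2 ⟨hX, v, y, t, hv, hQ, hlt.trans_le hxx'⟩

end MinorState

section MainInduction

open scoped Classical

lemma summable_potential (N : ℕ → ℕ) :
    Summable fun l => (1 / 2 : ℝ) ^ l * (1 / 16 : ℝ) ^ N l :=
  Summable.of_nonneg_of_le (fun l => by positivity)
    (fun l => mul_le_of_le_one_right (by positivity) (pow_le_one₀ (by norm_num) (by norm_num)))
    (summable_geometric_of_lt_one (r := (1 / 2 : ℝ)) (by norm_num) (by norm_num))

lemma potential_le_two (N : ℕ → ℕ) : ∑' l, (1 / 2 : ℝ) ^ l * (1 / 16 : ℝ) ^ N l ≤ 2 := by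
  refine ((summable_potential N).tsum_le_tsum (fun l => mul_le_of_le_one_right (by positivity)
    (pow_le_one₀ (by norm_num) (by norm_num))) ?_).trans_eq tsum_geometric_two
  exact summable_geometric_of_lt_one (r := (1 / 2 : ℝ)) (by norm_num) (by norm_num)

lemma potential_le {N N' : ℕ → ℕ} {k : ℕ} (h₁ : ∀ l ≤ k, N l ≤ N' l)
    (h₂ : ∀ l, k < l → N k + 1 ≤ N' l) :
    ∑' l, (1 / 2 : ℝ) ^ l * (1 / 16 : ℝ) ^ N' l ≤
      ∑ l ∈ Finset.range (k + 1), (1 / 2 : ℝ) ^ l * (1 / 16 : ℝ) ^ N l +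
        (1 / 2 : ℝ) ^ k * (1 / 16 : ℝ) ^ N k / 16 := by
  rw [← (summable_potential N').sum_add_tsum_nat_add (k + 1)]
  have hanti : ∀ {a b : ℕ}, a ≤ b → (1 / 16 : ℝ) ^ b ≤ (1 / 16 : ℝ) ^ a := fun h =>
    pow_le_pow_of_le_one (by norm_num) (by norm_num) h
  refine add_le_add (Finset.sum_le_sum fun l hl => ?_) ?_
  · exact mul_le_mul_of_nonneg_left (hanti (h₁ l (Nat.lt_succ_iff.1 (Finset.mem_range.1 hl))))
      (by positivity)
  · calc ∑' l, (1 / 2 : ℝ) ^ (l + (k + 1)) * (1 / 16 : ℝ) ^ N' (l + (k + 1))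
        ≤ ∑' l, (1 / 2 : ℝ) ^ l * ((1 / 2 : ℝ) ^ (k + 1) * (1 / 16 : ℝ) ^ (N k + 1)) := by
          refine ((summable_nat_add_iff (k + 1)).2 (summable_potential N')).tsum_le_tsum
            (fun l => ?_) ((summable_geometric_of_lt_one (by norm_num) (by norm_num)).mul_right _)
          rw [pow_add, mul_assoc]
          have := hanti (h₂ (l + (k + 1)) (by omega))
          gcongr
      _ = (1 / 2 : ℝ) ^ k * (1 / 16 : ℝ) ^ N k / 16 := by
          rw [tsum_mul_right, tsum_geometric_two]
          ring

variable {G : SimpleGraph V} {w : V → V → ℝ}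

/-- The load of the fractional cover built from a state: a weighted count of the members of `𝒳`
which are far from `z`. -/
noncomputable def stateLoad (G : SimpleGraph V) (w : V → V → ℝ) (r : ℕ) (U : ℝ) (s : Set V)
    (𝒳 : Finset (Set V)) (Q : Set V → V → ℝ → Prop) (z : V) : ℝ :=
  12 * r * 16 ^ r * 2 ^ (4 * r) *
    ∑' l : ℕ, (1 / 2 : ℝ) ^ l * (1 / 16 : ℝ) ^ linkCount G w s 𝒳 Q z (l * U)

/-- A root region of the state, as a connected union of few almost geodesic sets which touches all
members of `𝒳`. -/
lemma IsMinorState.exists_skeleton (hw : ∀ u v, G.Adj u v → 0 < w u v)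
    (hsymm : ∀ u v, w u v = w v u) {U : ℝ} (hU : 0 < U) {s : Set V} {𝒳 : Finset (Set V)}
    {Q : Set V → V → ℝ → Prop} (hS : IsMinorState G w s 𝒳 Q) :
    ∃ (h : V → ℝ) (A : Set V) (𝒴 : Finset (Set V)), (∀ x ∈ s, 0 ≤ h x) ∧
      (∀ x y t, ReachLe G w s x y t → h y ≤ h x + t) ∧ 𝒴.card ≤ 𝒳.card + 1 ∧ A ⊆ s ∧
      A.Nonempty ∧ PreconnectedIn G w A ∧ (∀ X ∈ 𝒳, ∃ u ∈ X, ∃ v ∈ A, G.Adj u v) ∧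
      (∀ a, a ∈ A ↔ ∃ Y ∈ 𝒴, a ∈ Y) ∧
      ∀ Y ∈ 𝒴, ∀ u ∈ Y, ∀ u' ∈ Y, ReachLe G w s u u' (|h u - h u'| + U) := by
  obtain ⟨v₀, hv₀⟩ := hS.nonempty
  obtain ⟨h, hh, hlip, hpath⟩ := exists_almost_geodesics hw hsymm hU hS.preconnected hv₀
  have hX : ∀ X, ∃ Y : Set V, X ∈ 𝒳 → (Y ⊆ s ∧ v₀ ∈ Y ∧ PreconnectedIn G w Y ∧
      (∀ u ∈ Y, ∀ u' ∈ Y, ReachLe G w s u u' (|h u - h u'| + U)) ∧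
      ∃ u ∈ X, ∃ v ∈ Y, G.Adj u v) := by
    intro X
    by_cases hX : X ∈ 𝒳
    · obtain ⟨u, hu, v, hv, huv⟩ := hS.touch X hX
      obtain ⟨Y, hY, h₁, h₂, h₃, h₄⟩ := hpath v hv
      exact ⟨Y, fun _ => ⟨hY, h₁, h₃, h₄, u, hu, v, h₂, huv⟩⟩
    · exact ⟨∅, fun h => absurd h hX⟩
  choose Yf hYf using hX
  obtain ⟨Y₀, hY₀, hv₀Y₀, -, hY₀c, hY₀g⟩ := hpath v₀ hv₀
  have hall : ∀ Y ∈ insert Y₀ (𝒳.image Yf), Y ⊆ s ∧ v₀ ∈ Y ∧ PreconnectedIn G w Y ∧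
      (∀ u ∈ Y, ∀ u' ∈ Y, ReachLe G w s u u' (|h u - h u'| + U)) := by
    intro Y hY
    rcases Finset.mem_insert.1 hY with rfl | hY
    · exact ⟨hY₀, hv₀Y₀, hY₀c, hY₀g⟩
    · obtain ⟨X, hX, rfl⟩ := Finset.mem_image.1 hY
      obtain ⟨h₁, h₂, h₃, h₄, -⟩ := hYf X hX
      exact ⟨h₁, h₂, h₃, h₄⟩
  refine ⟨h, {a | ∃ Y ∈ insert Y₀ (𝒳.image Yf), a ∈ Y}, insert Y₀ (𝒳.image Yf), hh, hlip, ?_, ?_,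
    ⟨v₀, Y₀, Finset.mem_insert_self _ _, hv₀Y₀⟩, ?_, ?_, fun a => Iff.rfl,
    fun Y hY => (hall Y hY).2.2.2⟩
  · exact (Finset.card_insert_le _ _).trans (Nat.succ_le_succ Finset.card_image_le)
  · rintro a ⟨Y, hY, ha⟩
    exact (hall Y hY).1 ha
  · refine preconnectedIn_of_center hsymm v₀ ?_
    rintro x ⟨Y, hY, hx⟩
    obtain ⟨t, ht⟩ := (hall Y hY).2.2.1 v₀ (hall Y hY).2.1 x hx
    exact ⟨t, ht.mono (fun a ha => ⟨Y, hY, ha⟩) le_rfl⟩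
  · intro X hX
    obtain ⟨-, -, -, -, u, hu, v, hv, huv⟩ := hYf X hX
    exact ⟨u, hu, v, ⟨Yf X, Finset.mem_insert_of_mem (Finset.mem_image_of_mem _ hX), hv⟩, huv⟩

/-- The distance from `z` to a nonempty set, rounded down to a multiple of `U`. -/
lemma exists_distance_scale (hw : ∀ u v, G.Adj u v → 0 < w u v) {U : ℝ} (hU : 0 < U) {s A : Set V}
    (hs : PreconnectedIn G w s) (hA : A ⊆ s) (hne : A.Nonempty) {z : V} (hz : z ∈ s) :
    ∃ n : ℕ, (∃ a ∈ A, ∃ t < (n + 1) * U, ReachLe G w s z a t) ∧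
      ∀ a ∈ A, ∀ t < n * U, ¬ ReachLe G w s z a t := by
  have hex : ∃ n : ℕ, ∃ a ∈ A, ∃ t < ((n : ℝ) + 1) * U, ReachLe G w s z a t := by
    obtain ⟨a, ha⟩ := hne
    obtain ⟨t, ht⟩ := hs z hz a (hA ha)
    refine ⟨⌊t / U⌋₊, a, ha, t, ?_, ht⟩
    rw [← div_lt_iff₀ hU]
    exact Nat.lt_floor_add_one _
  refine ⟨Nat.find hex, Nat.find_spec hex, fun a ha t ht h => ?_⟩
  rcases Nat.eq_zero_or_pos (Nat.find hex) with h0 | hpos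
  · rw [h0] at ht
    have := h.nonneg hw
    simp only [Nat.cast_zero, zero_mul] at ht
    linarith
  · refine Nat.find_min hex (Nat.sub_lt hpos one_pos) ⟨a, ha, t, ?_, h⟩
    rwa [Nat.cast_pred hpos, sub_add_cancel]

/-- The loads at the different radii average to at most the load of the state. -/
lemma IsMinorState.load_step (hw : ∀ u v, G.Adj u v → 0 < w u v) {U : ℝ} (hU : 0 < U) {r : ℕ}
    {s A : Set V} {𝒳 : Finset (Set V)} {Q : Set V → V → ℝ → Prop} (hS : IsMinorState G w s 𝒳 Q)
    (hr : 𝒳.card ≤ r) (hA : A ⊆ s) (hne : A.Nonempty) {z : V} {n : ℕ} {a : V}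
    (ha : a ∈ A) {t : ℝ} (hza : ReachLe G w s z a t) (ht : t < (n + 1) * U)
    (hfar : ∀ a ∈ A, ∀ t < n * U, ¬ ReachLe G w s z a t) :
    ∑ j ∈ Finset.range (4 * r + 1), (1 / 4 : ℝ) ^ j *
      ((if n ≤ j + 4 * r then 3 * (r : ℝ) else 0) + if z ∈ s \ thicken G w s A (j * U) then
        stateLoad G w r U (comp G w (s \ thicken G w s A (j * U)) z)
          (extendFamily G (comp G w (s \ thicken G w s A (j * U)) z) 𝒳 (thicken G w s A (j * U)))
          (extendPort G w s A (j * U) Q) z else 0) ≤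
      (∑ j ∈ Finset.range (4 * r + 1), (1 / 4 : ℝ) ^ j) * stateLoad G w r U s 𝒳 Q z := by
  set P : ℕ → Set V := fun j => thicken G w s A (j * U) with hP
  have hjU : ∀ j : ℕ, 0 ≤ (j : ℝ) * U := fun j => by positivity
  set T : ℕ → ℝ := fun j => ∑' l : ℕ, (1 / 2 : ℝ) ^ l * (1 / 16 : ℝ) ^
    linkCount G w (comp G w (s \ P j) z) (extendFamily G (comp G w (s \ P j) z) 𝒳 (P j))
      (extendPort G w s A (j * U) Q) z (l * U) with hT
  have hmain := sum_geometric_radius_le (r := r) (m := 4 * r) (W := 4 * r) (n := n)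
    (q := fun l => (1 / 16 : ℝ) ^ linkCount G w s 𝒳 Q z (l * U))
    (Ψ := fun j => if z ∈ s \ P j then T j else 0)
    (by rw [pow_mul]; norm_num)
    (fun l => pow_le_pow_of_le_one (by norm_num) (by norm_num)
      ((Finset.card_filter_le _ _).trans (by omega)))
    (fun l => pow_le_one₀ (by norm_num) (by norm_num)) ?_ ?_
  · set K : ℝ := 12 * r * 16 ^ r * 2 ^ (4 * r) with hK
    have hK0 : 0 ≤ K := by positivity
    have hKκ : K * ((1 / 4 : ℝ) * (1 / 16) ^ r * (1 / 2) ^ (4 * r)) = 3 * r := by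
      rw [hK, one_div_pow, one_div_pow]
      field_simp
      ring
    calc ∑ j ∈ Finset.range (4 * r + 1), (1 / 4 : ℝ) ^ j *
          ((if n ≤ j + 4 * r then 3 * (r : ℝ) else 0) +
            if z ∈ s \ P j then K * T j else 0)
        = K * ∑ j ∈ Finset.range (4 * r + 1), (1 / 4 : ℝ) ^ j *
          ((if z ∈ s \ P j then T j else 0) +
            if n ≤ j + 4 * r then (1 / 4 : ℝ) * (1 / 16) ^ r * (1 / 2) ^ (4 * r) else 0) := by
          rw [Finset.mul_sum]
          refine Finset.sum_congr rfl fun j _ => ?_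
          rw [mul_left_comm K, mul_add K, mul_ite, mul_ite, hKκ, mul_zero, add_comm]
      _ ≤ K * _ := mul_le_mul_of_nonneg_left hmain hK0
      _ = _ := by
          rw [← Finset.sum_mul, stateLoad, mul_left_comm]
  · intro j _ hjn
    split_ifs with hzP
    · have hjn' : (j : ℝ) ≤ n := by exact_mod_cast hjn
      have hk : ((n - j : ℕ) : ℝ) = n - j := Nat.cast_sub hjn
      rw [show n + 1 - j = (n - j) + 1 by omega]
      refine potential_le (N := fun l => linkCount G w s 𝒳 Q z (l * U)) (fun l hl => ?_)
        fun l hl => ?_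
      · refine linkCount_le_extend hw hS hA hne (hjU j) (L := n * U) hfar ?_
        have : (l : ℝ) ≤ n - j := by rw [← hk]; exact_mod_cast hl
        calc (l : ℝ) * U + j * U = (l + j) * U := by ring
          _ ≤ n * U := by gcongr; linarith
      · have hl' : (n : ℝ) - j + 1 ≤ l := by rw [← hk]; exact_mod_cast hl
        refine linkCount_lt_extend hw hS hA hne (hjU j) (L := n * U) hzP.2 hfar ?_ ?_ ha hza ?_
        · rw [hk]
          linarith
        · gcongr
        · calc t < (n + 1) * U := ht
            _ ≤ (l + j) * U := mul_le_mul_of_nonneg_right (by linarith) hU.le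
            _ = l * U + j * U := by ring
    · exact add_nonneg (Finset.sum_nonneg fun l _ => by positivity) (by positivity)
  · intro j _ hnj
    have hzP : z ∈ P j := by
      refine ⟨a, ha, hza.mono subset_rfl (ht.le.trans ?_)⟩
      have : (n : ℝ) + 1 ≤ j := by exact_mod_cast hnj
      gcongr
    rw [if_neg fun h => h.2 hzP]

lemma IsMinorState.exists_isFracCover [Fintype V] (hw : ∀ u v, G.Adj u v → 0 < w u v)
    (hsymm : ∀ u v, w u v = w v u) {U : ℝ} (hU : 0 < U) {r : ℕ} (hr : 1 ≤ r)
    (hG : ¬ HasCliqueMinor G r) {s : Set V} {𝒳 : Finset (Set V)} {Q : Set V → V → ℝ → Prop}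
    (hS : IsMinorState G w s 𝒳 Q) :
    ∃ μ, IsFracCover G w s (25 * r * U) (2 * r * U) (stateLoad G w r U s 𝒳 Q) μ := by
  induction hc : s.ncard using Nat.strong_induction_on generalizing s 𝒳 Q with
  | _ c ih =>
  subst hc
  obtain ⟨h, A, 𝒴, hh, hlip, h𝒴, hA, hne, hAc, htouch, hA𝒴, hgeo⟩ := hS.exists_skeleton hw hsymm hU
  have hr' : (1 : ℝ) ≤ r := by exact_mod_cast hr
  have hcard := hS.card_lt hG
  have h𝒴r : 𝒴.card ≤ r := by omega
  have hr𝒳 : 𝒳.card ≤ r := by omega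
  set P : ℕ → Set V := fun j => thicken G w s A (j * U) with hP
  have hjU : ∀ j : ℕ, 0 ≤ (j : ℝ) * U := fun j => by positivity
  set B : ℕ → Set V → V → ℝ := fun j s' => stateLoad G w r U s' (extendFamily G s' 𝒳 (P j))
    (extendPort G w s A (j * U) Q) with hB
  have hrec : ∀ j, ∃ μ, IsFracCover G w (s \ P j) (25 * r * U) (2 * r * U)
      (fun z => B j (comp G w (s \ P j) z) z) μ := by
    intro j
    refine IsFracCover.of_components hw hsymm (by positivity) fun z hz => ?_
    refine ih _ ?_ (hS.extend hw hsymm hA hne hAc (hjU j) htouch hz) rfl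
    refine Set.ncard_lt_ncard ⟨comp_subset.trans Set.sdiff_subset, fun hsub => ?_⟩
    obtain ⟨a, ha⟩ := hne
    exact (comp_subset (hsub (hA ha))).2 (subset_thicken hA (hjU j) ha)
  choose M hM using hrec
  set ν : ℝ := 8 * r * U with hν
  have hν0 : 0 < ν := by positivity
  have hWj : ∀ j ≤ 4 * r, ((j : ℝ) + 4 * r) * U ≤ ν := by
    intro j hj
    have : (j : ℝ) ≤ 4 * r := by exact_mod_cast hj
    rw [hν]
    gcongr
    linarith
  have hscale : ∀ z, ∃ n : ℕ, z ∈ s → (∃ a ∈ A, ∃ t < (n + 1) * U, ReachLe G w s z a t) ∧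
      ∀ a ∈ A, ∀ t < n * U, ¬ ReachLe G w s z a t := by
    intro z
    by_cases hz : z ∈ s
    · obtain ⟨n, hn⟩ := exists_distance_scale hw hU hS.preconnected hA hne hz
      exact ⟨n, fun _ => hn⟩
    · exact ⟨0, fun h => absurd h hz⟩
  choose n hn using hscale
  refine IsFracCover.average (m := 4 * r) (a := fun j => (1 / 4 : ℝ) ^ j) (P := P)
    (𝒩 := fun j => Finset.univ.filter fun C =>
      ∃ Y ∈ 𝒴, ∃ i, C = nearCluster G w s h ν ((j + 4 * r) * U) Y i)
    (M := M) (cnt := fun j z => if n z ≤ j + 4 * r then 3 * r else 0) (fun j => by positivity)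
    ?_ ?_ (fun j _ => hM j) ?_ ?_ ?_
  · intro j _ C hC
    obtain ⟨Y, -, i, rfl⟩ := (Finset.mem_filter.1 hC).2
    exact nearCluster_subset
  · intro j hj C hC x hx y hy
    obtain ⟨Y, hY, i, rfl⟩ := (Finset.mem_filter.1 hC).2
    refine (nearCluster_bounded hsymm (hgeo Y hY) hx hy).mono subset_rfl ?_
    have := hWj j hj
    have : U ≤ r * U := le_mul_of_one_le_left hU.le hr'
    linarith
  · intro z hz j _
    by_cases hnear : ∃ a ∈ A, ReachLe G w s z a (j * U + 2 * r * U)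
    · left
      obtain ⟨a, ha, hza⟩ := hnear
      obtain ⟨Y, hY, haY⟩ := (hA𝒴 a).1 ha
      refine ⟨_, Finset.mem_filter.2 ⟨Finset.mem_univ _, Y, hY, ⌊h a / ν⌋₊, rfl⟩, ?_⟩
      rintro x ⟨t, ht, hx⟩
      refine ⟨a, haY, ?_, ?_, ?_⟩
      · rw [← le_div_iff₀ hν0]
        exact Nat.floor_le (div_nonneg (hh a (hA ha)) hν0.le)
      · rw [← div_lt_iff₀ hν0]
        exact Nat.lt_floor_add_one _
      · exact ((((reachLe_openBall hw ht hx).mono hz le_rfl).symm hsymm).trans hza).mono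
          subset_rfl (by linarith)
    · right
      rintro x ⟨t, ht, hx⟩
      refine ⟨hz ⟨t, ht, hx⟩, ?_⟩
      rintro ⟨a, ha, hxa⟩
      exact hnear ⟨a, ha, (((reachLe_openBall hw ht hx).mono hz le_rfl).trans hxa).mono
        subset_rfl (by linarith)⟩
  · intro z hz j hj
    split_ifs with hnj
    · have := card_nearCluster_le (ν := ν) (R := (j + 4 * r) * U) hsymm hh hlip hν0 (hWj j hj) 𝒴 z
        ((Finset.univ.filter fun C =>
          ∃ Y ∈ 𝒴, ∃ i, C = nearCluster G w s h ν ((j + 4 * r) * U) Y i).filter fun C => z ∈ C)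
        (fun C hC => ⟨(Finset.mem_filter.1 hC).2,
          (Finset.mem_filter.1 (Finset.mem_filter.1 hC).1).2⟩)
      exact_mod_cast this.trans (Nat.mul_le_mul_left 3 h𝒴r)
    · rw [Nat.cast_nonpos, Finset.card_eq_zero, Finset.filter_eq_empty_iff]
      intro C hC hzC
      obtain ⟨Y, hY, i, rfl⟩ := (Finset.mem_filter.1 hC).2
      obtain ⟨a, haY, -, -, hza⟩ := hzC
      refine (hn z hz).2 a ((hA𝒴 a).2 ⟨Y, hY, haY⟩) _ ?_ hza
      have : (j : ℝ) + 4 * r < n z := by exact_mod_cast not_le.1 hnj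
      gcongr
  · intro z hz
    obtain ⟨⟨a, ha, t, ht, hza⟩, hfar⟩ := hn z hz
    exact hS.load_step hw hU hr𝒳 hA hne ha hza ht hfar

/-- Every graph without a `K_r` minor has a fractional cover of load exponential in `r`. -/
theorem exists_isFracCover_univ [Fintype V] (hw : ∀ u v, G.Adj u v → 0 < w u v)
    (hsymm : ∀ u v, w u v = w v u) {U : ℝ} (hU : 0 < U) {r : ℕ} (hr : 1 ≤ r)
    (hG : ¬ HasCliqueMinor G r) :
    ∃ μ, IsFracCover G w Set.univ (25 * r * U) (2 * r * U)
      (fun _ => 24 * r * 16 ^ r * 2 ^ (4 * r)) μ := by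
  refine IsFracCover.of_components (B := fun _ _ => 24 * r * 16 ^ r * 2 ^ (4 * r)) hw hsymm
    (by positivity) fun z hz => ?_
  have hS : IsMinorState G w (comp G w Set.univ z) ∅ fun _ _ _ => False :=
    ⟨⟨z, mem_comp_self hz⟩, preconnectedIn_comp hw hsymm, by simp, by simp, by simp, by simp,
      by simp, by simp⟩
  obtain ⟨μ, hμ⟩ := hS.exists_isFracCover hw hsymm hU hr hG
  refine ⟨μ, hμ.nonneg, hμ.subset, hμ.bounded, hμ.padded, fun x hx => (hμ.load x hx).trans ?_⟩
  calc _ ≤ 12 * (r : ℝ) * 16 ^ r * 2 ^ (4 * r) * 2 :=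
        mul_le_mul_of_nonneg_left (potential_le_two _) (by positivity)
    _ = _ := by ring

end MainInduction

section Rounding

open scoped Classical

/-- Sequential sampling: give every vertex the first sample allowed for it. A set `S` of vertices
receives a common sample with probability at least the ratio of the mass allowed for all of `S` to
the mass allowed for some member of `S`. -/
lemma exists_pmf_sequential_sampling {Ω : Type*} [Fintype Ω] (ω : Ω → ℝ≥0∞) (A : V → Set Ω)
    (hfin : ∀ v, ∀ x ∈ A v, ω x ≠ ⊤) (hpos : ∀ v, ∃ x ∈ A v, ω x ≠ 0) (U : Finset V) :
    ∃ μ : PMF (V → Ω), (∀ F ∈ μ.support, ∀ v ∈ U, F v ∈ A v ∧ ω (F v) ≠ 0) ∧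
      ∀ S : Set V, S ⊆ U → ∀ z ∈ S, (∑ x, if ∀ v ∈ S, x ∈ A v then ω x else 0) ≤
        μ.toOuterMeasure {F | ∀ y ∈ S, F y = F z} *
          ∑ x, if ∃ v ∈ S, x ∈ A v then ω x else 0 := by
  induction U using Finset.strongInduction with
  | H U ih =>
  choose F₀ hF₀ using hpos
  rcases U.eq_empty_or_nonempty with rfl | ⟨v₁, hv₁⟩
  · refine ⟨PMF.pure F₀, by simp, fun S hS z hz => absurd (hS hz) (by simp)⟩
  set m : Ω → ℝ≥0∞ := fun x => if ∃ v ∈ U, x ∈ A v then ω x else 0 with hm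
  have hmne : ∀ x, m x ≠ 0 → (∃ v ∈ U, x ∈ A v) ∧ ω x ≠ 0 := by
    intro x hx
    by_cases h : ∃ v ∈ U, x ∈ A v
    · exact ⟨h, by simpa [hm, if_pos h] using hx⟩
    · exact absurd (if_neg h) hx
  have hZ0 : ∑' x, m x ≠ 0 := by
    rw [tsum_fintype]
    refine fun h => (hF₀ v₁).2 ?_
    have := Finset.sum_eq_zero_iff.1 h (F₀ v₁) (Finset.mem_univ _)
    exact (if_pos ⟨v₁, hv₁, (hF₀ v₁).1⟩ : m (F₀ v₁) = ω (F₀ v₁)).symm.trans this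
  have hZt : ∑' x, m x ≠ ⊤ := by
    rw [tsum_fintype]
    refine (ENNReal.sum_lt_top.2 fun x _ => ?_).ne
    simp only [hm]
    split_ifs with h
    · obtain ⟨v, -, hv⟩ := h
      exact (hfin v x hv).lt_top
    · exact ENNReal.zero_lt_top
  have hrec : ∀ x, ∃ μ : PMF (V → Ω), (∃ v ∈ U, x ∈ A v) →
      (∀ F ∈ μ.support, ∀ v ∈ U, x ∉ A v → F v ∈ A v ∧ ω (F v) ≠ 0) ∧
      ∀ S : Set V, (∀ v ∈ S, v ∈ U ∧ x ∉ A v) → ∀ z ∈ S,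
        (∑ x, if ∀ v ∈ S, x ∈ A v then ω x else 0) ≤
        μ.toOuterMeasure {F | ∀ y ∈ S, F y = F z} *
          ∑ x, if ∃ v ∈ S, x ∈ A v then ω x else 0 := by
    intro x
    by_cases hx : ∃ v ∈ U, x ∈ A v
    · obtain ⟨μ, hμ₁, hμ₂⟩ := ih (U.filter fun v => x ∉ A v) (by
        obtain ⟨v, hv, hxv⟩ := hx
        exact Finset.filter_ssubset.2 ⟨v, hv, by simpa using hxv⟩)
      exact ⟨μ, fun _ => ⟨fun F hF v hv hxv => hμ₁ F hF v (Finset.mem_filter.2 ⟨hv, hxv⟩),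
        fun S hS z hz => hμ₂ S (fun v hv => Finset.mem_coe.2 (Finset.mem_filter.2 (hS v hv))) z hz⟩⟩
    · exact ⟨PMF.pure F₀, fun h => absurd h hx⟩
  choose M hM using hrec
  set upd : Ω → (V → Ω) → V → Ω := fun x F v => if x ∈ A v then x else F v with hupd
  refine ⟨(PMF.normalize m hZ0 hZt).bind fun x => (M x).map (upd x), ?_, ?_⟩
  · intro F hF v hv
    obtain ⟨x, hx, hF⟩ := (PMF.mem_support_bind_iff _ _ _).1 hF
    obtain ⟨F', hF', rfl⟩ := (PMF.mem_support_map_iff _ _ _).1 hF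
    obtain ⟨hxU, hx0⟩ := hmne x ((PMF.mem_support_normalize_iff _ _ _).1 hx)
    by_cases hxv : x ∈ A v
    · simp only [hupd, if_pos hxv]
      exact ⟨hxv, hx0⟩
    · simp only [hupd, if_neg hxv]
      exact (hM x hxU).1 F' hF' v hv hxv
  · intro S hS z hz
    set I := ∑ x, if ∀ v ∈ S, x ∈ A v then ω x else 0 with hI
    set J := ∑ x, if ∃ v ∈ S, x ∈ A v then ω x else 0 with hJ
    set E : Set (V → Ω) := {F | ∀ y ∈ S, F y = F z} with hE
    have hZ : ∑' x, m x = J + ∑ x, if (∃ v ∈ U, x ∈ A v) ∧ ¬ ∃ v ∈ S, x ∈ A v then ω x else 0 := by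
      rw [tsum_fintype, hJ, ← Finset.sum_add_distrib]
      refine Finset.sum_congr rfl fun x _ => ?_
      by_cases h : ∃ v ∈ S, x ∈ A v
      · have hU : ∃ v ∈ U, x ∈ A v := by
          obtain ⟨v, hv, hxv⟩ := h
          exact ⟨v, hS hv, hxv⟩
        simp [hm, h, hU]
      · simp [hm, h]
    have hterm : ∀ x, (if ∀ v ∈ S, x ∈ A v then ω x else 0) * J +
        (if (∃ v ∈ U, x ∈ A v) ∧ ¬ ∃ v ∈ S, x ∈ A v then ω x else 0) * I ≤
        m x * ((M x).map (upd x)).toOuterMeasure E * J := by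
      intro x
      rw [PMF.toOuterMeasure_map_apply]
      by_cases hJx : ∃ v ∈ S, x ∈ A v
      · simp only [hJx, not_true, and_false, if_false, zero_mul, add_zero]
        split_ifs with hIx
        · have h1 : (M x).toOuterMeasure (upd x ⁻¹' E) = 1 := by
            rw [PMF.toOuterMeasure_apply_eq_one_iff]
            intro F _ y hy
            simp only [hupd, if_pos (hIx y hy), if_pos (hIx z hz)]
          have h2 : m x = ω x := if_pos ⟨z, hS hz, hIx z hz⟩
          rw [h1, h2, mul_one]
        · simp
      · rw [if_neg (fun h => hJx ⟨z, hz, h z hz⟩), zero_mul, zero_add]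
        by_cases hUx : ∃ v ∈ U, x ∈ A v
        · have h2 : m x = ω x := if_pos hUx
          rw [if_pos ⟨hUx, hJx⟩, h2, mul_assoc]
          refine mul_le_mul_right (((hM x hUx).2 S
            (fun v hv => ⟨hS hv, fun h => hJx ⟨v, hv, h⟩⟩) z hz).trans ?_) _
          refine mul_le_mul_left (measure_mono ?_) _
          intro F hF y hy
          have hy' : x ∉ A y := fun h => hJx ⟨y, hy, h⟩
          have hz' : x ∉ A z := fun h => hJx ⟨z, hz, h⟩
          simp only [hupd, if_neg hy', if_neg hz']
          exact hF y hy
        · simp [hUx]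
    have hsum : I * ∑' x, m x ≤ ∑ x, m x * ((M x).map (upd x)).toOuterMeasure E * J := by
      calc I * ∑' x, m x = ∑ x, ((if ∀ v ∈ S, x ∈ A v then ω x else 0) * J +
            (if (∃ v ∈ U, x ∈ A v) ∧ ¬ ∃ v ∈ S, x ∈ A v then ω x else 0) * I) := by
            rw [Finset.sum_add_distrib, ← Finset.sum_mul, ← Finset.sum_mul, hZ, mul_add, ← hI]
            congr 1
            rw [mul_comm]
        _ ≤ _ := Finset.sum_le_sum fun x _ => hterm x
    rw [PMF.toOuterMeasure_bind_apply]
    simp only [PMF.normalize_apply]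
    calc I = (∑' x, m x)⁻¹ * (I * ∑' x, m x) := by
          rw [mul_left_comm, ENNReal.inv_mul_cancel hZ0 hZt, mul_one]
      _ ≤ (∑' x, m x)⁻¹ * ∑ x, m x * ((M x).map (upd x)).toOuterMeasure E * J :=
          mul_le_mul_right hsum _
      _ = _ := by
          rw [tsum_fintype (f := fun x => m x * (∑' x, m x)⁻¹ *
            ((M x).map (upd x)).toOuterMeasure E), ← Finset.sum_mul, ← mul_assoc,
            Finset.mul_sum (a := (∑' x, m x)⁻¹)]
          congr 1
          refine Finset.sum_congr rfl fun x _ => ?_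
          ring

/-- The amount of thresholds at which the superlevel set of `g` is `T`. -/
noncomputable def levelMass (g : V → ℝ) (T : Finset V) : ℝ≥0∞ :=
  volume {θ : ℝ | 0 < θ ∧ ∀ v, v ∈ T ↔ θ ≤ g v}

lemma levelMass_le (g : V → ℝ) {T : Finset V} {v : V} (hv : v ∈ T) :
    levelMass g T ≤ ENNReal.ofReal (g v) := by
  refine (measure_mono (t := Set.Ioc 0 (g v)) fun θ hθ => ⟨hθ.1, (hθ.2 v).1 hv⟩).trans ?_
  simp

variable [Fintype V]

lemma ofReal_le_sum_levelMass (g : V → ℝ) {S : Set V} {lo : ℝ} (h : ∀ v ∈ S, lo ≤ g v) :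
    ENNReal.ofReal lo ≤ ∑ T : Finset V, if ∀ v ∈ S, v ∈ T then levelMass g T else 0 := by
  rw [← Finset.sum_filter]
  calc ENNReal.ofReal lo = volume (Set.Ioc 0 lo) := by simp
    _ ≤ volume (⋃ T ∈ Finset.univ.filter fun T : Finset V => ∀ v ∈ S, v ∈ T,
        {θ : ℝ | 0 < θ ∧ ∀ v, v ∈ T ↔ θ ≤ g v}) := by
        refine measure_mono fun θ hθ => ?_
        refine Set.mem_iUnion₂.2 ⟨Finset.univ.filter fun v => θ ≤ g v, ?_, hθ.1, by simp⟩
        simpa using fun v hv => hθ.2.trans (h v hv)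
    _ ≤ _ := measure_biUnion_finset_le _ _

lemma sum_levelMass_le_ofReal (g : V → ℝ) {S : Set V} {hi : ℝ} (h : ∀ v ∈ S, g v ≤ hi) :
    (∑ T : Finset V, if ∃ v ∈ S, v ∈ T then levelMass g T else 0) ≤ ENNReal.ofReal hi := by
  rw [← Finset.sum_filter]
  have hmeas : ∀ T : Finset V, MeasurableSet {θ : ℝ | 0 < θ ∧ ∀ v, v ∈ T ↔ θ ≤ g v} := by
    intro T
    have : {θ : ℝ | 0 < θ ∧ ∀ v, v ∈ T ↔ θ ≤ g v} =
        Set.Ioi 0 ∩ ⋂ v, if v ∈ T then Set.Iic (g v) else Set.Ioi (g v) := by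
      ext θ
      rw [Set.mem_inter_iff, Set.mem_iInter]
      refine and_congr_right fun _ => forall_congr' fun v => ?_
      by_cases hv : v ∈ T <;> simp [hv]
    rw [this]
    refine measurableSet_Ioi.inter (MeasurableSet.iInter fun v => ?_)
    split_ifs
    exacts [measurableSet_Iic, measurableSet_Ioi]
  simp only [levelMass]
  rw [← measure_biUnion_finset (fun T _ T' _ hTT' => ?_) fun T _ => hmeas T]
  · calc _ ≤ volume (Set.Ioc 0 hi) := by
          refine measure_mono fun θ hθ => ?_
          obtain ⟨T, hT, hθ0, hθ⟩ := Set.mem_iUnion₂.1 hθ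
          obtain ⟨v, hv, hvT⟩ := (Finset.mem_filter.1 hT).2
          exact ⟨hθ0, ((hθ v).1 hvT).trans (h v hv)⟩
      _ = _ := by simp
  · refine Set.disjoint_left.2 fun θ hθ hθ' => hTT' ?_
    ext v
    rw [hθ.2, hθ'.2]

/-- Rounding a fractional assignment `g` of the vertices to labels: the label function is constant
on `S` with probability at least the ratio of lower to upper bounds for the mass on `S`. -/
theorem exists_pmf_rounding {κ : Type*} [Fintype κ] (g : κ → V → ℝ) (hpos : ∀ v, ∃ C, 0 < g C v) :
    ∃ μ : PMF (V → κ), (∀ f ∈ μ.support, ∀ v, 0 < g (f v) v) ∧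
      ∀ (S : Set V) (z) (_ : z ∈ S) (lo hi : κ → ℝ), (∀ C, ∀ v ∈ S, lo C ≤ g C v ∧ g C v ≤ hi C) →
        ∑ C, ENNReal.ofReal (lo C) ≤
          μ.toOuterMeasure {f | ∀ y ∈ S, f y = f z} * ∑ C, ENNReal.ofReal (hi C) := by
  obtain ⟨μ, hμ₁, hμ₂⟩ := exists_pmf_sequential_sampling
    (fun x : κ × Finset V => levelMass (g x.1) x.2) (fun v => {x | v ∈ x.2})
    (fun v x hx => ((levelMass_le (g x.1) hx).trans_lt ENNReal.ofReal_lt_top).ne) (fun v => by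
      obtain ⟨C, hC⟩ := hpos v
      have := (ENNReal.ofReal_pos.2 hC).trans_le
        (ofReal_le_sum_levelMass (g C) (S := {v}) (lo := g C v) (by simp))
      obtain ⟨T, -, hT⟩ := Finset.exists_ne_zero_of_sum_ne_zero this.ne'
      by_cases hvT : v ∈ T
      · exact ⟨(C, T), hvT, by simpa [hvT] using hT⟩
      · simp [hvT] at hT) Finset.univ
  refine ⟨μ.map fun F v => (F v).1, fun f hf v => ?_, fun S z hz lo hi hS => ?_⟩
  · obtain ⟨F, hF, rfl⟩ := (PMF.mem_support_map_iff _ _ _).1 hf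
    obtain ⟨hv, h0⟩ := hμ₁ F hF v (Finset.mem_univ v)
    exact ENNReal.ofReal_pos.1 (h0.bot_lt.trans_le (levelMass_le _ hv))
  · rw [PMF.toOuterMeasure_map_apply]
    have h := hμ₂ S (by simp) z hz
    simp only [Set.mem_ofPred_eq, Fintype.sum_prod_type] at h
    calc ∑ C, ENNReal.ofReal (lo C) ≤ _ :=
          Finset.sum_le_sum fun C _ => ofReal_le_sum_levelMass (g C) fun v hv => (hS C v hv).1
      _ ≤ _ := h
      _ ≤ _ := by
          refine mul_le_mul' (measure_mono fun F hF y hy => by simp only [hF y hy]) ?_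
          exact Finset.sum_le_sum fun C _ => sum_levelMass_le_ofReal (g C) fun v hv => (hS C v hv).2

end Rounding

section PaddedPartition

open scoped Classical

variable {G : SimpleGraph V} {w : V → V → ℝ}

/-- The distance from `v` to the complement of `C`, truncated at `ρ`. -/
noncomputable def depth (G : SimpleGraph V) (w : V → V → ℝ) (ρ : ℝ) (C : Set V) (v : V) : ℝ :=
  sInf (insert ρ {t | ∃ y ∉ C, ReachLe G w Set.univ v y t})

section depth

variable {ρ : ℝ} {C : Set V} {v : V}

lemma bddBelow_depth (hw : ∀ u v, G.Adj u v → 0 < w u v) (hρ : 0 ≤ ρ) :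
    BddBelow (insert ρ {t | ∃ y ∉ C, ReachLe G w Set.univ v y t}) :=
  ⟨0, by
    rintro t (rfl | ⟨y, -, h⟩)
    exacts [hρ, h.nonneg hw]⟩

lemma depth_nonpos (hw : ∀ u v, G.Adj u v → 0 < w u v) (hρ : 0 ≤ ρ) (hv : v ∉ C) :
    depth G w ρ C v ≤ 0 :=
  csInf_le (bddBelow_depth hw hρ) (Or.inr ⟨v, hv, ReachLe.refl (Set.mem_univ v) le_rfl⟩)

lemma le_depth (h : openBall G w v ρ ⊆ C) : ρ ≤ depth G w ρ C v := by
  refine le_csInf ⟨ρ, Or.inl rfl⟩ ?_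
  rintro t (rfl | ⟨y, hy, ht⟩)
  · exact le_rfl
  · by_contra! hlt
    exact hy (h ⟨t, hlt, ht⟩)

lemma depth_le_add (hw : ∀ u v, G.Adj u v → 0 < w u v) (hρ : 0 ≤ ρ) {x y : V} {t : ℝ}
    (h : ReachLe G w Set.univ x y t) : depth G w ρ C x ≤ depth G w ρ C y + t := by
  rw [← sub_le_iff_le_add]
  refine le_csInf ⟨ρ, Or.inl rfl⟩ ?_
  rintro t' (rfl | ⟨y', hy', ht'⟩)
  · linarith [csInf_le (bddBelow_depth (G := G) (w := w) (C := C) (v := x) hw hρ) (Or.inl rfl),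
      h.nonneg hw, show depth G w t' C x = sInf _ from rfl]
  · linarith [csInf_le (bddBelow_depth (G := G) (w := w) (C := C) (v := x) hw hρ)
      (Or.inr ⟨y', hy', h.trans ht'⟩), show depth G w ρ C x = sInf _ from rfl]

lemma abs_depth_sub_le (hw : ∀ u v, G.Adj u v → 0 < w u v) (hsymm : ∀ u v, w u v = w v u)
    (hρ : 0 ≤ ρ) {x y : V} {t : ℝ} (ht : 0 ≤ t) (h : y ∈ gball G w x t) :
    depth G w ρ C x - t ≤ depth G w ρ C y ∧ depth G w ρ C y ≤ depth G w ρ C x + t := by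
  have key : ∀ ε > 0, ReachLe G w Set.univ x y (t + ε) := fun ε hε => reachLe_of_dG_le ht hε h
  constructor <;> refine le_of_forall_pos_le_add fun ε hε => ?_
  · linarith [depth_le_add (C := C) hw hρ (key ε hε)]
  · linarith [depth_le_add (C := C) hw hρ ((key ε hε).symm hsymm)]

end depth

/-- The exponential weight profile `max (exp x - 1) 0`. -/
noncomputable def expProfile (x : ℝ) : ℝ := max (exp x - 1) 0

lemma expProfile_nonneg (x : ℝ) : 0 ≤ expProfile x := le_max_right _ _

lemma expProfile_mono {x y : ℝ} (h : x ≤ y) : expProfile x ≤ expProfile y :=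
  max_le_max_right 0 (sub_le_sub_right (exp_le_exp.2 h) 1)

lemma expProfile_of_nonpos {x : ℝ} (h : x ≤ 0) : expProfile x = 0 :=
  max_eq_right (by linarith [exp_le_one_iff.2 h])

lemma expProfile_add_le (x : ℝ) {y : ℝ} (hy : 0 ≤ y) :
    expProfile (x + y) ≤ exp y * expProfile x + (exp y - 1) := by
  have h1 : 1 ≤ exp y := one_le_exp hy
  have h2 : exp x - 1 ≤ expProfile x := le_max_left _ _
  refine max_le ?_ (add_nonneg (mul_nonneg (exp_pos y).le (expProfile_nonneg x)) (by linarith))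
  rw [exp_add]
  nlinarith [exp_pos y]

variable [Fintype V]

/-- A fractional cover of load at most `S` yields a padded random partition. -/
theorem IsFracCover.exists_padded_pmf (hw : ∀ u v, G.Adj u v → 0 < w u v)
    (hsymm : ∀ u v, w u v = w v u) {S D ρ : ℝ} (hS : 0 < S) (hρ : 0 < ρ) {μ : Set V → ℝ}
    (hμ : IsFracCover G w Set.univ D ρ (fun _ => S) μ) :
    ∃ P : PMF (V → Set V), (∀ f ∈ P.support, ∀ x y, f x = f y → ReachLe G w Set.univ x y D) ∧
      ∀ z t, 0 ≤ t → t ≤ ρ / 4 → ENNReal.ofReal (exp (-(16 * Real.log (S + 1) * t / ρ))) ≤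
        P.toOuterMeasure {f | ∀ y ∈ gball G w z t, f y = f z} := by
  set l : ℝ := 4 * Real.log (S + 1) / ρ with hl
  have hl0 : 0 < l := div_pos (mul_pos four_pos (Real.log_pos (by linarith))) hρ
  have hlρ : exp (l * (ρ / 4)) = S + 1 := by
    rw [hl, show 4 * Real.log (S + 1) / ρ * (ρ / 4) = Real.log (S + 1) by field_simp,
      Real.exp_log (by linarith)]
  set g : Set V → V → ℝ := fun C v => μ C * expProfile (l * (depth G w ρ C v - ρ / 2)) with hg
  have hout : ∀ C v x, v ∉ C → x ≤ depth G w ρ C v + ρ / 4 →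
      expProfile (l * (x - ρ / 2)) = 0 := fun C v x hv hx =>
    expProfile_of_nonpos (mul_nonpos_of_nonneg_of_nonpos hl0.le
      (by linarith [depth_nonpos hw hρ.le hv]))
  obtain ⟨P, hP₁, hP₂⟩ := exists_pmf_rounding g fun v => by
    have h1 := zero_lt_one.trans_le (hμ.padded v (Set.subset_univ _))
    obtain ⟨C, -, hC⟩ := Finset.exists_ne_zero_of_sum_ne_zero h1.ne'
    have hsub : openBall G w v ρ ⊆ C := by
      by_contra h
      exact hC (if_neg h)
    rw [if_pos hsub] at hC
    refine ⟨C, mul_pos ((hμ.nonneg C).lt_of_ne' hC) (lt_max_of_lt_left (sub_pos.2 ?_))⟩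
    exact one_lt_exp_iff.2 (mul_pos hl0 (by linarith [le_depth hsub]))
  have hmem : ∀ f ∈ P.support, ∀ v, μ (f v) ≠ 0 ∧ v ∈ f v := by
    intro f hf v
    have h := hP₁ f hf v
    refine ⟨fun h0 => by simp [hg, h0] at h, ?_⟩
    by_contra hv
    have h0 := hout (f v) v (depth G w ρ (f v) v) hv (by linarith)
    simp only [hg, h0, mul_zero, lt_self_iff_false] at h
  refine ⟨P, fun f hf x y hxy => ?_, fun z t ht htρ => ?_⟩
  · exact hμ.bounded (f x) (hmem f hf x).1 x (hmem f hf x).2 y (hxy ▸ (hmem f hf y).2)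
  have hz : z ∈ gball G w z t :=
    (dG_le_of_reachLe (ReachLe.refl (Set.mem_univ z) le_rfl)).trans
      (ENNReal.ofReal_le_ofReal ht)
  set lo : Set V → ℝ := fun C => μ C * expProfile (l * (depth G w ρ C z - t - ρ / 2)) with hlo
  set hi : Set V → ℝ := fun C => μ C * expProfile (l * (depth G w ρ C z + t - ρ / 2)) with hhi
  have hlo0 : ∀ C, 0 ≤ lo C := fun C => mul_nonneg (hμ.nonneg C) (expProfile_nonneg _)
  have hhi0 : ∀ C, 0 ≤ hi C := fun C => mul_nonneg (hμ.nonneg C) (expProfile_nonneg _)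
  have hround := hP₂ (gball G w z t) z hz lo hi fun C y hy => by
    obtain ⟨h1, h2⟩ := abs_depth_sub_le (C := C) hw hsymm hρ.le ht hy
    constructor <;> refine mul_le_mul_of_nonneg_left (expProfile_mono ?_) (hμ.nonneg C) <;>
      exact mul_le_mul_of_nonneg_left (by linarith) hl0.le
  rw [← ENNReal.ofReal_sum_of_nonneg fun C _ => hlo0 C,
    ← ENNReal.ofReal_sum_of_nonneg fun C _ => hhi0 C] at hround
  set a : ℝ := exp (l * (2 * t)) with ha
  have ha1 : 1 ≤ a := one_le_exp (by positivity)
  have hSlo : S ≤ ∑ C, lo C := by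
    calc S = S * 1 := (mul_one S).symm
      _ ≤ S * ∑ C, (if openBall G w z ρ ⊆ C then μ C else 0) :=
          mul_le_mul_of_nonneg_left (hμ.padded z (Set.subset_univ _)) hS.le
      _ ≤ _ := by
          rw [Finset.mul_sum]
          refine Finset.sum_le_sum fun C _ => ?_
          split_ifs with hC
          · rw [mul_comm]
            refine mul_le_mul_of_nonneg_left (le_max_of_le_left ?_) (hμ.nonneg C)
            rw [le_sub_iff_add_le, ← hlρ]
            exact exp_le_exp.2 (mul_le_mul_of_nonneg_left (by linarith [le_depth hC]) hl0.le)
          · simpa using hlo0 C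
  have hhile : ∑ C, hi C ≤ a * ∑ C, lo C + (a - 1) * S := by
    calc ∑ C, hi C ≤ ∑ C, (a * lo C + (a - 1) * if z ∈ C then μ C else 0) := by
          refine Finset.sum_le_sum fun C _ => ?_
          split_ifs with hC
          · have := expProfile_add_le (l * (depth G w ρ C z - t - ρ / 2)) (y := l * (2 * t))
              (by positivity)
            rw [← mul_add, show depth G w ρ C z - t - ρ / 2 + 2 * t =
              depth G w ρ C z + t - ρ / 2 by ring] at this
            calc hi C ≤ μ C * (a * expProfile (l * (depth G w ρ C z - t - ρ / 2)) + (a - 1)) :=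
                  mul_le_mul_of_nonneg_left this (hμ.nonneg C)
              _ = _ := by
                  simp only [hlo]
                  ring
          · rw [show hi C = 0 by
              simp only [hhi, hout C z _ hC (show depth G w ρ C z + t ≤ _ by linarith), mul_zero]]
            have := hlo0 C
            positivity
      _ = a * ∑ C, lo C + (a - 1) * ∑ C, (if z ∈ C then μ C else 0) := by
          rw [Finset.sum_add_distrib, Finset.mul_sum, Finset.mul_sum]
      _ ≤ _ := add_le_add le_rfl
          (mul_le_mul_of_nonneg_left (hμ.load z (Set.mem_univ z)) (by linarith))
  have hratio : ∑ C, hi C ≤ a ^ 2 * ∑ C, lo C := by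
    nlinarith [mul_nonneg (sub_nonneg.2 ha1) (sub_nonneg.2 hSlo),
      mul_nonneg (mul_self_nonneg (a - 1)) (hS.le.trans hSlo)]
  have hexp : exp (-(16 * Real.log (S + 1) * t / ρ)) = (a ^ 2)⁻¹ := by
    rw [ha, ← exp_nat_mul, ← exp_neg, hl]
    congr 2
    push_cast
    ring
  set p := P.toOuterMeasure {f | ∀ y ∈ gball G w z t, f y = f z} with hp
  have hL : 0 < ∑ C, lo C := hS.trans_le hSlo
  have ha2 : 0 < a ^ 2 := by positivity
  have h1 : ENNReal.ofReal (∑ C, lo C) ≤ p * ENNReal.ofReal (a ^ 2) *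
      ENNReal.ofReal (∑ C, lo C) := by
    rw [mul_assoc, ← ENNReal.ofReal_mul ha2.le]
    exact hround.trans (mul_le_mul_right (ENNReal.ofReal_le_ofReal hratio) _)
  have h2 : 1 ≤ p * ENNReal.ofReal (a ^ 2) := by
    rw [← ENNReal.mul_le_mul_iff_left (ENNReal.ofReal_pos.2 hL).ne' ENNReal.ofReal_ne_top,
      one_mul]
    exact h1
  rw [hexp, ENNReal.ofReal_inv_of_pos ha2]
  exact ENNReal.inv_le_iff_le_mul (fun _ => (ENNReal.ofReal_pos.2 ha2).ne')
    (fun h => absurd h ENNReal.ofReal_ne_top) |>.2 (by rwa [mul_comm])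

end PaddedPartition

lemma log_load_le {r : ℕ} (hr : 1 ≤ r) :
    Real.log (24 * r * 16 ^ r * 2 ^ (4 * r) + 1) ≤ 14 * r * Real.log 2 := by
  have h1 : (r : ℝ) ≤ 2 ^ r := by exact_mod_cast Nat.lt_two_pow_self.le
  have h2 : (24 * r * 16 ^ r * 2 ^ (4 * r) + 1 : ℝ) ≤ 2 ^ (14 * r) := by
    have h3 : (1 : ℝ) ≤ 2 ^ (9 * r) := one_le_pow₀ (by norm_num)
    calc (24 * r * 16 ^ r * 2 ^ (4 * r) + 1 : ℝ)
        ≤ 24 * 2 ^ r * 16 ^ r * 2 ^ (4 * r) + 1 := by gcongr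
      _ = 24 * 2 ^ (9 * r) + 1 := by
          rw [show (16 : ℝ) = 2 ^ 4 by norm_num, ← pow_mul]
          ring
      _ ≤ 2 ^ 5 * 2 ^ (9 * r) := by linarith
      _ ≤ 2 ^ (14 * r) := by
          rw [← pow_add]
          exact pow_le_pow_right₀ (by norm_num) (by omega)
  calc Real.log (24 * r * 16 ^ r * 2 ^ (4 * r) + 1) ≤ Real.log (2 ^ (14 * r)) :=
        Real.log_le_log (by positivity) h2
    _ = _ := by rw [Real.log_pow]; push_cast; ring

/-- Theorem 1.3 / `thm:main-weak`.
Every `K_r`-minor-free finite edge-weighted graph admits an `O(r)`-padded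
probabilistic partition: there are a constant `C` (so `β = C·r ≤ O(r)`) and a universal
constant `δ > 0` independent of `r` such that for every `Δ > 0` there is a distribution
over partitions (encoded by cluster-labelling functions `f : V → ℕ`) whose clusters have
weak diameter at most `Δ`, and for every vertex `z` and `0 ≤ γ ≤ δ` the ball
`B_G(z, γΔ)` is contained in the cluster of `z` with probability at least `2^{-C·r·γ}`.
(The polynomial-time samplability claim is not formalized.) -/
theorem padded_partition_minor_free_weak :
    ∃ C δ : ℝ, 0 < C ∧ 0 < δ ∧
      ∀ (r : ℕ), 2 ≤ r →
      ∀ (V : Type) (_ : Fintype V) (G : SimpleGraph V) (w : V → V → ℝ),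
        (∀ u v, G.Adj u v → 0 < w u v) → (∀ u v, w u v = w v u) →
        ¬ HasCliqueMinor G r →
        ∀ Δ : ℝ, 0 < Δ →
        ∃ μ : PMF (V → ℕ),
          (∀ f ∈ μ.support, ∀ x y : V, f x = f y → dG G w x y ≤ ENNReal.ofReal Δ) ∧
          ∀ (z : V) (γ : ℝ), 0 ≤ γ → γ ≤ δ →
            ENNReal.ofReal ((2:ℝ) ^ (-(C * r * γ))) ≤
              μ.toOuterMeasure {f | gball G w z (γ * Δ) ⊆ {y | f y = f z}} := by
  refine ⟨2800, 1 / 50, by norm_num, by norm_num, ?_⟩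
  intro r hr V _ G w hw hsymm hG Δ hΔ
  have hr1 : 1 ≤ r := by omega
  have hr0 : (0 : ℝ) < r := by exact_mod_cast hr1
  obtain ⟨μ, hμ⟩ := exists_isFracCover_univ hw hsymm (U := Δ / (25 * r)) (by positivity) hr1 hG
  rw [show 25 * (r : ℝ) * (Δ / (25 * r)) = Δ by field_simp,
    show 2 * (r : ℝ) * (Δ / (25 * r)) = 2 * Δ / 25 by field_simp] at hμ
  obtain ⟨P, hP₁, hP₂⟩ := hμ.exists_padded_pmf hw hsymm (by positivity) (by positivity)
  classical
  let e := Fintype.equivFin (Set V)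
  have he : Function.Injective fun C => (e C : ℕ) := Fin.val_injective.comp e.injective
  refine ⟨P.map fun f v => (e (f v) : ℕ), fun f hf x y hxy => ?_, fun z γ hγ hγδ => ?_⟩
  · obtain ⟨g, hg, rfl⟩ := (PMF.mem_support_map_iff _ _ _).1 hf
    exact dG_le_of_reachLe (hP₁ g hg x y (he hxy))
  · rw [PMF.toOuterMeasure_map_apply]
    refine le_trans (ENNReal.ofReal_le_ofReal ?_) ((hP₂ z (γ * Δ) (by positivity) ?_).trans
      (measure_mono fun f hf y hy => congrArg (fun C => (e C : ℕ)) (hf y hy)))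
    · rw [rpow_def_of_pos two_pos, exp_le_exp]
      have h := mul_le_mul_of_nonneg_left (log_load_le hr1) (show 0 ≤ 200 * γ by positivity)
      rw [show ∀ x : ℝ, 16 * x * (γ * Δ) / (2 * Δ / 25) = 200 * γ * x from fun x => by
        field_simp
        ring]
      linarith
    · nlinarith

end KPRpaper
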